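/- arXiv:math/0612718 — 5 statements merged into one kernel-verified Lean document; each statement's English description precedes it below -/
import Mathlib

section
/- (Γ-liminf inequality) Let Ω ⊂ ℝ^d be a compact convex set with nonempty interior and ν = f·𝓛^d a probability measure on Ω with density f ∈ L¹(Ω). Let Σ_n ⊆ Ω be nonempty finite sets with #Σ_n ≤ n such that the empirical measures μ_{Σ_n} converge weakly-* to a probability measure μ on Ω, and write μ = ρ·𝓛^d + μ_sing with ρ ∈ L¹(Ω) and μ_sing singular with respect to 𝓛^d. Then liminf_{n→∞} n^{1/d} F(Σ_n) ≥ θ_d ∫_Ω f(x) ρ(x)^{-1/d} dx, where the integrand is interpreted as +∞ on the set where f > 0 and ρ = 0. -/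
open MeasureTheory Filter Topology ENNReal

/-- The average-distance functional `F(Σ) = ∫_Ω dist(x, Σ) dν(x)` for a finite set `Σ`. -/
noncomputable def avgDist {d : ℕ} (Ω : Set (EuclideanSpace ℝ (Fin d)))
    (ν : Measure (EuclideanSpace ℝ (Fin d)))
    (s : Finset (EuclideanSpace ℝ (Fin d))) : ℝ :=
  ∫ x in Ω, Metric.infDist x (s : Set (EuclideanSpace ℝ (Fin d))) ∂ν

/-- The empirical probability measure `μ_Σ = (1/#Σ) ∑_{x ∈ Σ} δ_x` of a finite set. -/
noncomputable def empMeasure {E : Type*} [MeasurableSpace E] (s : Finset E) : Measure E :=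
  (s.card : ℝ≥0∞)⁻¹ • ∑ x ∈ s, MeasureTheory.Measure.dirac x

/-- The unit cube `[0,1]^d`. -/
def unitCube (d : ℕ) : Set (EuclideanSpace ℝ (Fin d)) :=
  {x | ∀ i, x i ∈ Set.Icc (0 : ℝ) 1}

/-- The constant `θ_d`, defined as the infimum over all sequences of (nonempty) finite sets
`Σ_n ⊆ [0,1]^d` with `#Σ_n ≤ n` of `liminf_n n^{1/d} ∫_{[0,1]^d} dist(x, Σ_n) dx`. -/
noncomputable def theta (d : ℕ) : ℝ≥0∞ :=
  ⨅ (S : ℕ → Finset (EuclideanSpace ℝ (Fin d)))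
    (_ : ∀ n : ℕ, 1 ≤ n → (S n : Set (EuclideanSpace ℝ (Fin d))) ⊆ unitCube d ∧
      (S n).Nonempty ∧ (S n).card ≤ n),
    Filter.liminf (fun n : ℕ => (n : ℝ≥0∞) ^ ((1 : ℝ) / d) *
      ∫⁻ x in unitCube d, EMetric.infEdist x (S n : Set (EuclideanSpace ℝ (Fin d)))) Filter.atTop

/-- The closed cube with centre `x` and half side `r`. -/
def cubeAt {d : ℕ} (x : EuclideanSpace ℝ (Fin d)) (r : ℝ) : Set (EuclideanSpace ℝ (Fin d)) :=
  {y | ∀ i, |y i - x i| ≤ r}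

/-- The affine map sending the unit cube onto the cube with centre `x` and half side `|r|`. -/
noncomputable def cubeMap {d : ℕ} (x : EuclideanSpace ℝ (Fin d)) (r : ℝ)
    (u : EuclideanSpace ℝ (Fin d)) : EuclideanSpace ℝ (Fin d) :=
  x + r • ((2 : ℝ) • u - WithLp.toLp 2 (fun _ => 1))

section Cubes

variable {d : ℕ}

lemma cubeMap_apply (x : EuclideanSpace ℝ (Fin d)) (r : ℝ) (u : EuclideanSpace ℝ (Fin d))
    (i : Fin d) : cubeMap x r u i = x i + r * (2 * u i - 1) := by
  simp [cubeMap]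

lemma continuous_cubeMap (r : ℝ) :
    Continuous fun p : EuclideanSpace ℝ (Fin d) × EuclideanSpace ℝ (Fin d) =>
      cubeMap p.1 r p.2 := by
  unfold cubeMap
  fun_prop

lemma cubeAt_eq_preimage (x : EuclideanSpace ℝ (Fin d)) {r : ℝ} (hr : 0 ≤ r) :
    cubeAt x r = WithLp.ofLp ⁻¹' Metric.closedBall (WithLp.ofLp x) r := by
  ext y
  simp [cubeAt, dist_pi_le_iff hr, Real.dist_eq]

lemma isClosed_cubeAt (x : EuclideanSpace ℝ (Fin d)) (r : ℝ) : IsClosed (cubeAt x r) := by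
  have : cubeAt x r = ⋂ i, {y | |y i - x i| ≤ r} := by
    ext y
    simp [cubeAt]
  rw [this]
  exact isClosed_iInter fun i => isClosed_le (by fun_prop) continuous_const

lemma volume_cubeAt (x : EuclideanSpace ℝ (Fin d)) {r : ℝ} (hr : 0 ≤ r) :
    volume (cubeAt x r) = ENNReal.ofReal ((2 * r) ^ d) := by
  rw [cubeAt_eq_preimage x hr, (PiLp.volume_preserving_ofLp (Fin d)).measure_preimage
    Metric.isClosed_closedBall.measurableSet.nullMeasurableSet, Real.volume_pi_closedBall _ hr,
    Fintype.card_fin]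

lemma preimage_cubeMap_cubeAt (x : EuclideanSpace ℝ (Fin d)) {s : ℝ} (hs : s ≠ 0) :
    cubeMap x s ⁻¹' cubeAt x |s| = unitCube d := by
  ext u
  simp only [Set.mem_preimage, cubeAt, Set.mem_ofPred_eq, unitCube, cubeMap_apply, Set.mem_Icc]
  refine forall_congr' fun i => ?_
  have hs' := abs_pos.2 hs
  rw [add_sub_cancel_left, abs_mul, mul_le_iff_le_one_right hs', abs_le]
  constructor <;> rintro ⟨h₁, h₂⟩ <;> constructor <;> linarith

lemma unitCube_eq_cubeAt :
    unitCube d = cubeAt (WithLp.toLp 2 (fun _ : Fin d => (1 / 2 : ℝ))) (1 / 2) := by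
  ext u
  refine forall_congr' fun i => ?_
  simp only [Set.mem_Icc, abs_le]
  constructor <;> rintro ⟨h₁, h₂⟩ <;> constructor <;> linarith

lemma measurableSet_unitCube : MeasurableSet (unitCube d) := by
  rw [unitCube_eq_cubeAt]
  exact (isClosed_cubeAt _ _).measurableSet

lemma volume_unitCube : volume (unitCube d) = 1 := by
  rw [unitCube_eq_cubeAt, volume_cubeAt _ (by norm_num)]
  simp

lemma map_cubeMap_volume (x : EuclideanSpace ℝ (Fin d)) {s : ℝ} (hs : s ≠ 0) :
    ∃ C : ℝ≥0∞, Measure.map (cubeMap x s) volume = C • volume := by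
  have h : cubeMap x s = (fun y => y + (x - s • WithLp.toLp 2 (fun _ => 1))) ∘
      fun u => (2 * s) • u := by
    funext u
    simp only [cubeMap, Function.comp_apply, smul_sub, smul_smul]
    rw [mul_comm s 2]
    abel
  rw [h, ← Measure.map_map (by fun_prop) (by fun_prop),
    Measure.map_addHaar_smul _ (mul_ne_zero two_ne_zero hs), Measure.map_smul,
    (measurePreserving_add_right volume _).map_eq]
  exact ⟨_, rfl⟩

lemma lintegral_cubeMap (x : EuclideanSpace ℝ (Fin d)) {s : ℝ} (hs : s ≠ 0)
    {g : EuclideanSpace ℝ (Fin d) → ℝ≥0∞} (hg : Measurable g) :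
    ∫⁻ u in unitCube d, g (cubeMap x s u) =
      (∫⁻ y in cubeAt x |s|, g y) / volume (cubeAt x |s|) := by
  obtain ⟨C, hC⟩ := map_cubeMap_volume x hs
  have hm : Measurable (cubeMap x s) := by
    unfold cubeMap
    fun_prop
  have hQ := (isClosed_cubeAt x |s|).measurableSet
  have key : ∀ g : EuclideanSpace ℝ (Fin d) → ℝ≥0∞, Measurable g →
      ∫⁻ u in unitCube d, g (cubeMap x s u) = C * ∫⁻ y in cubeAt x |s|, g y := by
    intro g hg
    rw [← preimage_cubeMap_cubeAt x hs, ← setLIntegral_map hQ hg hm, hC,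
      Measure.restrict_smul, lintegral_smul_measure, smul_eq_mul]
  have h1 := key (fun _ => 1) measurable_const
  simp only [lintegral_const, Measure.restrict_apply MeasurableSet.univ, Set.univ_inter,
    volume_unitCube, one_mul] at h1
  rw [key g hg, ENNReal.eq_inv_of_mul_eq_one_left h1.symm, mul_comm, ENNReal.div_eq_inv_mul,
    mul_comm]

lemma ae_tendsto_div_cubeAt (m : Measure (EuclideanSpace ℝ (Fin d))) [IsFiniteMeasure m] :
    ∀ᵐ x, Tendsto (fun r => m (cubeAt x r) / volume (cubeAt x r)) (𝓝[>] 0)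
      (𝓝 (m.rnDeriv volume x)) := by
  have hp := PiLp.volume_preserving_ofLp (Fin d)
  have he : MeasurableEmbedding (WithLp.ofLp : EuclideanSpace ℝ (Fin d) → Fin d → ℝ) :=
    (MeasurableEquiv.toLp 2 (Fin d → ℝ)).symm.measurableEmbedding
  have h1 := (IsUnifLocDoublingMeasure.vitaliFamily (volume : Measure (Fin d → ℝ))
    1).ae_tendsto_rnDeriv (m.map WithLp.ofLp)
  have h2 := hp.quasiMeasurePreserving.ae h1
  have h3 := he.rnDeriv_map m volume
  rw [hp.map_eq] at h3
  filter_upwards [h2, h3] with x hx hx'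
  rw [← hx']
  have hball := IsUnifLocDoublingMeasure.tendsto_closedBall_filterAt
    (volume : Measure (Fin d → ℝ)) (K := 1) (x := WithLp.ofLp x) (l := 𝓝[>] (0 : ℝ))
    (fun _ => WithLp.ofLp x) id tendsto_id (by
      filter_upwards [self_mem_nhdsWithin] with r hr
      exact Metric.mem_closedBall_self (by simpa using (Set.mem_Ioi.1 hr).le))
  refine (hx.comp hball).congr' ?_
  filter_upwards [self_mem_nhdsWithin] with r hr
  have hr0 : 0 ≤ r := (Set.mem_Ioi.1 hr).le
  simp only [Function.comp_apply, id]
  rw [cubeAt_eq_preimage x hr0, he.map_apply, hp.measure_preimage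
    Metric.isClosed_closedBall.measurableSet.nullMeasurableSet]

end Cubes

section Competitors

variable {d : ℕ}

/-- The uniform grid of mesh `1 / K` in the unit cube. -/
noncomputable def unitGrid (d K : ℕ) : Finset (EuclideanSpace ℝ (Fin d)) :=
  Finset.univ.image fun j : Fin d → Fin (K + 1) => WithLp.toLp 2 fun i => (j i : ℝ) / K

lemma card_unitGrid_le (d K : ℕ) : (unitGrid d K).card ≤ (K + 1) ^ d := by
  refine Finset.card_image_le.trans ?_
  simp

lemma unitGrid_nonempty (d K : ℕ) : (unitGrid d K).Nonempty :=
  Finset.univ_nonempty.image _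

lemma unitGrid_subset (d : ℕ) {K : ℕ} (hK : 1 ≤ K) :
    (unitGrid d K : Set (EuclideanSpace ℝ (Fin d))) ⊆ unitCube d := by
  intro y hy
  obtain ⟨j, -, rfl⟩ := Finset.mem_image.1 (Finset.mem_coe.1 hy)
  intro i
  have hK' : (0 : ℝ) < K := by exact_mod_cast hK
  have hj : ((j i : ℕ) : ℝ) ≤ K := by exact_mod_cast Nat.lt_succ_iff.1 (j i).2
  exact ⟨by positivity, (div_le_one hK').2 hj⟩

lemma exists_mem_unitGrid_dist_le {K : ℕ} (hK : 1 ≤ K) {u : EuclideanSpace ℝ (Fin d)}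
    (hu : u ∈ unitCube d) : ∃ y ∈ unitGrid d K, dist u y ≤ √d / K := by
  have hK' : (0 : ℝ) < K := by exact_mod_cast hK
  have hle : ∀ i, ⌊K * u i⌋₊ < K + 1 := fun i =>
    Nat.lt_succ_iff.2 (Nat.floor_le_of_le (mul_le_of_le_one_right hK'.le (hu i).2))
  refine ⟨_, Finset.mem_image_of_mem _ (Finset.mem_univ fun i => ⟨⌊K * u i⌋₊, hle i⟩), ?_⟩
  have hi : ∀ i, dist (u i) ((⌊K * u i⌋₊ : ℝ) / K) ≤ 1 / K := by
    intro i
    have h1 := Nat.floor_le (mul_nonneg hK'.le (hu i).1)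
    have h2 := Nat.lt_floor_add_one (K * u i)
    rw [Real.dist_eq, le_div_iff₀ hK', ← abs_of_pos hK', ← abs_mul, abs_of_pos hK', sub_mul,
      div_mul_cancel₀ _ hK'.ne', abs_le]
    constructor <;> linarith
  rw [EuclideanSpace.dist_eq]
  calc √(∑ i, dist (u i) ((⌊K * u i⌋₊ : ℝ) / K) ^ 2)
      ≤ √(∑ _i : Fin d, (1 / (K : ℝ)) ^ 2) :=
        Real.sqrt_le_sqrt (Finset.sum_le_sum fun i _ => by gcongr; exact hi i)
    _ = √d / K := by
        rw [Finset.sum_const, Finset.card_univ, Fintype.card_fin, nsmul_eq_mul,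
          Real.sqrt_mul (Nat.cast_nonneg d), Real.sqrt_sq (by positivity), mul_one_div]

/-- Pull a point back to the coordinates of the cube `cubeAt x r` and project it onto the
unit cube. -/
noncomputable def clampCube (x : EuclideanSpace ℝ (Fin d)) (r : ℝ)
    (t : EuclideanSpace ℝ (Fin d)) : EuclideanSpace ℝ (Fin d) :=
  WithLp.toLp 2 fun i => max 0 (min 1 ((t i - x i + r) / (2 * r)))

lemma clampCube_mem (x : EuclideanSpace ℝ (Fin d)) (r : ℝ) (t : EuclideanSpace ℝ (Fin d)) :
    clampCube x r t ∈ unitCube d := fun _ =>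
  ⟨le_max_left _ _, max_le zero_le_one (min_le_left _ _)⟩

lemma dist_clampCube_le (x : EuclideanSpace ℝ (Fin d)) {r : ℝ} (hr : 0 < r)
    {u : EuclideanSpace ℝ (Fin d)} (hu : u ∈ unitCube d) (t : EuclideanSpace ℝ (Fin d)) :
    2 * r * dist u (clampCube x r t) ≤ dist (cubeMap x r u) t := by
  have hi : ∀ i, 2 * r * dist (u i) (clampCube x r t i) ≤ dist (cubeMap x r u i) (t i) := by
    intro i
    obtain ⟨h0, h1⟩ := hu i
    set w := (t i - x i + r) / (2 * r) with hw
    have hw' : t i = x i + r * (2 * w - 1) := by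
      rw [hw]
      field_simp
      ring
    have hc : |u i - max 0 (min 1 w)| ≤ |u i - w| := by
      rcases le_total w 0 with h | h
      · rw [min_eq_right (h.trans zero_le_one), max_eq_left h, sub_zero, abs_of_nonneg h0]
        exact le_trans (by linarith) (le_abs_self _)
      · rcases le_total w 1 with h' | h'
        · rw [min_eq_right h', max_eq_right h]
        · rw [min_eq_left h', max_eq_right zero_le_one, abs_sub_comm, abs_sub_comm (u i),
            abs_of_nonneg (by linarith)]
          exact le_trans (by linarith) (le_abs_self _)
    rw [cubeMap_apply, hw', Real.dist_eq, Real.dist_eq]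
    have : x i + r * (2 * u i - 1) - (x i + r * (2 * w - 1)) = 2 * r * (u i - w) := by ring
    rw [this, abs_mul, abs_of_pos (by positivity : 0 < 2 * r)]
    exact mul_le_mul_of_nonneg_left hc (by positivity)
  rw [EuclideanSpace.dist_eq, EuclideanSpace.dist_eq,
    ← Real.sqrt_sq (by positivity : 0 ≤ 2 * r), ← Real.sqrt_mul (by positivity), Finset.mul_sum]
  refine Real.sqrt_le_sqrt (Finset.sum_le_sum fun i _ => ?_)
  rw [← mul_pow]
  exact pow_le_pow_left₀ (by positivity) (hi i) 2

lemma lt_dist_of_notMem_cubeAt {x : EuclideanSpace ℝ (Fin d)} {r η : ℝ} (hr : 0 < r)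
    {u t : EuclideanSpace ℝ (Fin d)} (hu : u ∈ unitCube d) (ht : t ∉ cubeAt x (r + η)) :
    η < dist (cubeMap x r u) t := by
  simp only [cubeAt, Set.mem_ofPred_eq, not_forall, not_le] at ht
  obtain ⟨i, hi⟩ := ht
  obtain ⟨h0, h1⟩ := hu i
  have h2 : |cubeMap x r u i - x i| ≤ r := by
    rw [cubeMap_apply, abs_le]
    constructor <;> nlinarith
  have h3 : |t i - x i| ≤ |cubeMap x r u i - t i| + |cubeMap x r u i - x i| := by
    rw [abs_sub_comm (cubeMap x r u i) (t i)]
    exact abs_sub_le _ _ _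
  have h4 : |cubeMap x r u i - t i| ≤ dist (cubeMap x r u) t := by
    rw [dist_eq_norm]
    exact PiLp.norm_apply_le (cubeMap x r u - t) i
  linarith

open Classical in
/-- A finite set adapted to the unit cube that serves every point at least as well as `T` serves
its image in the cube `cubeAt x r`, and at least as well as a grid. -/
lemma exists_competitor (x : EuclideanSpace ℝ (Fin d)) {r η : ℝ} (hr : 0 < r) {K : ℕ}
    (hK : 1 ≤ K) (hη : 2 * r * (√d / K) ≤ η) (T : Finset (EuclideanSpace ℝ (Fin d))) :
    ∃ S : Finset (EuclideanSpace ℝ (Fin d)),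
      (S : Set (EuclideanSpace ℝ (Fin d))) ⊆ unitCube d ∧ S.Nonempty ∧
      S.card ≤ (T.filter (· ∈ cubeAt x (r + η))).card + (K + 1) ^ d ∧
      ∀ u ∈ unitCube d, ENNReal.ofReal (2 * r) * Metric.infEDist u S ≤
        min (Metric.infEDist (cubeMap x r u) T) (ENNReal.ofReal (2 * r * (√d / K))) := by
  refine ⟨(T.filter (· ∈ cubeAt x (r + η))).image (clampCube x r) ∪ unitGrid d K, ?_,
    (unitGrid_nonempty d K).mono Finset.subset_union_right, ?_, ?_⟩
  · rw [Finset.coe_union]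
    refine Set.union_subset ?_ (unitGrid_subset d hK)
    intro y hy
    obtain ⟨t, -, rfl⟩ := Finset.mem_image.1 (Finset.mem_coe.1 hy)
    exact clampCube_mem x r t
  · exact (Finset.card_union_le _ _).trans
      (add_le_add Finset.card_image_le (card_unitGrid_le d K))
  · intro u hu
    set S := (T.filter (· ∈ cubeAt x (r + η))).image (clampCube x r) ∪ unitGrid d K with hS
    have hpt : ∀ y ∈ S, ∀ D : ℝ, 2 * r * dist u y ≤ D →
        ENNReal.ofReal (2 * r) * Metric.infEDist u S ≤ ENNReal.ofReal D := by
      intro y hy D hD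
      calc ENNReal.ofReal (2 * r) * Metric.infEDist u S
          ≤ ENNReal.ofReal (2 * r) * edist u y := by
            gcongr
            exact Metric.infEDist_le_edist_of_mem (Finset.mem_coe.2 hy)
        _ = ENNReal.ofReal (2 * r * dist u y) := by
            rw [edist_dist, ENNReal.ofReal_mul (p := 2 * r) (by positivity)]
        _ ≤ ENNReal.ofReal D := ENNReal.ofReal_le_ofReal hD
    have hgrid : ENNReal.ofReal (2 * r) * Metric.infEDist u S ≤
        ENNReal.ofReal (2 * r * (√d / K)) := by
      obtain ⟨y, hy, hd⟩ := exists_mem_unitGrid_dist_le hK hu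
      exact hpt y (Finset.mem_union_right _ hy) _ (by gcongr)
    refine le_min (Metric.le_infEDist.2 fun t ht => ?_) hgrid
    rw [edist_dist]
    by_cases htQ : t ∈ cubeAt x (r + η)
    · exact hpt (clampCube x r t) (Finset.mem_union_left _ (Finset.mem_image_of_mem _
        (Finset.mem_filter.2 ⟨Finset.mem_coe.1 ht, htQ⟩))) _ (dist_clampCube_le x hr hu t)
    · exact hgrid.trans (ENNReal.ofReal_le_ofReal
        (hη.trans (lt_dist_of_notMem_cubeAt hr hu htQ).le))

end Competitors

/-- Near-optimality of `theta` is uniform over all competitors of large cardinality. -/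
lemma eventually_le_of_lt_theta {d : ℕ} {c : ℝ≥0∞} (hc : c < theta d) :
    ∀ᶠ m : ℕ in atTop, ∀ S : Finset (EuclideanSpace ℝ (Fin d)),
      (S : Set (EuclideanSpace ℝ (Fin d))) ⊆ unitCube d → S.Nonempty → S.card ≤ m →
      c ≤ (m : ℝ≥0∞) ^ ((1 : ℝ) / d) * ∫⁻ u in unitCube d, Metric.infEDist u S := by
  by_contra hcon
  rw [not_eventually] at hcon
  let P : ℕ → Finset (EuclideanSpace ℝ (Fin d)) → Prop := fun m S =>
    (S : Set (EuclideanSpace ℝ (Fin d))) ⊆ unitCube d ∧ S.Nonempty ∧ S.card ≤ m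
  let B : ℕ → Finset (EuclideanSpace ℝ (Fin d)) → Prop := fun m S =>
    (m : ℝ≥0∞) ^ ((1 : ℝ) / d) * ∫⁻ u in unitCube d, Metric.infEDist u S < c
  have hex : ∀ m : ℕ, ∃ S, (1 ≤ m → P m S) ∧ ((∃ S, P m S ∧ B m S) → B m S) := by
    intro m
    by_cases h : ∃ S, P m S ∧ B m S
    · obtain ⟨S, hP, hB⟩ := h
      exact ⟨S, fun _ => hP, fun _ => hB⟩
    · refine ⟨{0}, fun hm => ⟨?_, Finset.singleton_nonempty _, by simpa using hm⟩,
        fun h' => (h h').elim⟩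
      simp [unitCube]
  choose S hSP hSB using hex
  have hle : theta d ≤ liminf (fun n : ℕ => (n : ℝ≥0∞) ^ ((1 : ℝ) / d) *
      ∫⁻ x in unitCube d, Metric.infEDist x (S n)) atTop := iInf₂_le S hSP
  refine (hle.trans (liminf_le_of_frequently_le' (hcon.mono fun m hm => ?_))).not_gt hc
  push Not at hm
  obtain ⟨T, h1, h2, h3, h4⟩ := hm
  exact (hSB m ⟨T, ⟨h1, h2, h3⟩, h4⟩).le

section Counting

variable {E : Type*} [MeasurableSpace E]

open Classical in
lemma empMeasure_apply (s : Finset E) {A : Set E} (hA : MeasurableSet A) :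
    empMeasure s A = (s.card : ℝ≥0∞)⁻¹ * ((s.filter (· ∈ A)).card : ℝ≥0∞) := by
  simp [empMeasure, Measure.dirac_apply' _ hA, Set.indicator_apply]

lemma isProbabilityMeasure_empMeasure {s : Finset E} (hs : s.Nonempty) :
    IsProbabilityMeasure (empMeasure s) := by
  refine ⟨?_⟩
  rw [empMeasure_apply s MeasurableSet.univ]
  simp only [Set.mem_univ, Finset.filter_true]
  exact ENNReal.inv_mul_cancel (by simpa using hs.ne_empty) (by simp)

open Classical in
/-- Asymptotic bound for the number of points of `S n` in a closed set. -/
lemma eventually_card_filter_le [TopologicalSpace E] [OpensMeasurableSpace E]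
    [HasOuterApproxClosed E] {S : ℕ → Finset E}
    (hS : ∀ n, 1 ≤ n → (S n).Nonempty ∧ (S n).card ≤ n)
    {μ : Measure E} [IsProbabilityMeasure μ]
    (hconv : ∀ g : BoundedContinuousFunction E ℝ,
      Tendsto (fun n => ∫ x, g x ∂(empMeasure (S n))) atTop (𝓝 (∫ x, g x ∂μ)))
    {F : Set E} (hF : IsClosed F) {a : ℝ} (ha : μ F < ENNReal.ofReal a) :
    ∀ᶠ n : ℕ in atTop, (((S n).filter (· ∈ F)).card : ℝ) ≤ n * a := by
  have ha0 : 0 < a := ENNReal.ofReal_pos.1 (bot_le.trans_lt ha)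
  let P : ℕ → ProbabilityMeasure E := fun n =>
    ⟨empMeasure (S (n + 1)), isProbabilityMeasure_empMeasure (hS (n + 1) (by lia)).1⟩
  have hP : Tendsto P atTop (𝓝 (⟨μ, inferInstance⟩ : ProbabilityMeasure E)) :=
    ProbabilityMeasure.tendsto_iff_forall_integral_tendsto.2 fun g =>
      (hconv g).comp (tendsto_add_atTop_nat 1)
  have hlim : limsup (fun n => empMeasure (S (n + 1)) F) atTop ≤ μ F := by
    have h := ProbabilityMeasure.limsup_measure_closed_le_of_tendsto hP hF
    simpa [P] using h
  have hev := eventually_lt_of_limsup_lt (hlim.trans_lt ha)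
  obtain ⟨N, hN⟩ := eventually_atTop.1 hev
  filter_upwards [eventually_ge_atTop (N + 1)] with n hn
  obtain ⟨k, rfl⟩ : ∃ k, n = k + 1 := ⟨n - 1, by lia⟩
  have h := hN k (by lia)
  obtain ⟨hne, hcard⟩ := hS (k + 1) (by lia)
  have hc0 : ((S (k + 1)).card : ℝ≥0∞) ≠ 0 := by simpa using hne.ne_empty
  rw [empMeasure_apply _ hF.measurableSet, ← ENNReal.div_eq_inv_mul,
    ENNReal.div_lt_iff (Or.inl hc0) (Or.inl (by simp)), ← ENNReal.ofReal_natCast,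
    ← ENNReal.ofReal_natCast, ← ENNReal.ofReal_mul ha0.le,
    ENNReal.ofReal_lt_ofReal_iff'] at h
  have hcard' : ((S (k + 1)).card : ℝ) ≤ ((k + 1 : ℕ) : ℝ) := by exact_mod_cast hcard
  nlinarith [h.1]

end Counting

section LocalBound

variable {d : ℕ}

lemma exists_measure_cubeAt_lt {μ : Measure (EuclideanSpace ℝ (Fin d))} [IsFiniteMeasure μ]
    (x : EuclideanSpace ℝ (Fin d)) (r : ℝ) {a : ℝ≥0∞} (ha : μ (cubeAt x r) < a) :
    ∃ η > 0, μ (cubeAt x (r + η)) < a := by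
  have hInter : ⋂ k : ℕ, cubeAt x (r + 1 / ((k : ℝ) + 1)) = cubeAt x r := by
    ext y
    simp only [Set.mem_iInter]
    refine ⟨fun h i => ?_, fun h k i => (h i).trans (le_add_of_nonneg_right (by positivity))⟩
    refine ge_of_tendsto' (x := (atTop : Filter ℕ)) ?_ fun k => h k i
    simpa using tendsto_one_div_add_atTop_nhds_zero_nat.const_add r
  have hanti : Antitone fun k : ℕ => cubeAt x (r + 1 / ((k : ℝ) + 1)) := by
    intro k l hkl y hy i
    refine (hy i).trans ?_
    gcongr
  have hlim := tendsto_measure_iInter_atTop (μ := μ)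
    (fun k : ℕ => (isClosed_cubeAt x (r + 1 / ((k : ℝ) + 1))).measurableSet.nullMeasurableSet)
    hanti ⟨0, measure_ne_top _ _⟩
  rw [hInter] at hlim
  obtain ⟨k, hk⟩ := (hlim.eventually_lt_const ha).exists
  exact ⟨1 / ((k : ℝ) + 1), by positivity, hk⟩

/-- The share of the grid points in the counting estimate at truncation level `N`. -/
noncomputable def gridDensity (d N : ℕ) : ℝ := 1 / N + (2 * √d / N) ^ d

lemma gridDensity_pos (d : ℕ) {N : ℕ} (hN : 1 ≤ N) : 0 < gridDensity d N := by
  have : (0 : ℝ) < N := by exact_mod_cast hN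
  unfold gridDensity
  positivity

lemma tendsto_gridDensity (hd : 1 ≤ d) : Tendsto (gridDensity d) atTop (𝓝 0) := by
  have h1 : Tendsto (fun N : ℕ => 1 / (N : ℝ)) atTop (𝓝 0) := tendsto_one_div_atTop_nhds_zero_nat
  have h2 : Tendsto (fun N : ℕ => 2 * √d / (N : ℝ)) atTop (𝓝 0) :=
    tendsto_const_div_atTop_nhds_zero_nat _
  have h3 := h1.add (h2.pow d)
  rwa [zero_pow (by lia), add_zero] at h3

/-- The local lower bound for the truncated and rescaled distance, averaged over a cube. -/
lemma le_liminf_lintegral_min (hd : 1 ≤ d) {c : ℝ≥0∞} (hc : c < theta d)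
    {S : ℕ → Finset (EuclideanSpace ℝ (Fin d))}
    (hS : ∀ n, 1 ≤ n → (S n).Nonempty ∧ (S n).card ≤ n)
    {μ : Measure (EuclideanSpace ℝ (Fin d))} [IsProbabilityMeasure μ]
    (hconv : ∀ g : BoundedContinuousFunction (EuclideanSpace ℝ (Fin d)) ℝ,
      Tendsto (fun n => ∫ x, g x ∂(empMeasure (S n))) atTop (𝓝 (∫ x, g x ∂μ)))
    (x : EuclideanSpace ℝ (Fin d)) {r : ℝ} (hr : 0 < r) {N : ℕ} (hN : 1 ≤ N) :
    c * (μ (cubeAt x r) / volume (cubeAt x r) + ENNReal.ofReal (gridDensity d N)) ^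
        (-(1 : ℝ) / d) ≤
      liminf (fun n : ℕ => ∫⁻ u in unitCube d,
        min ((n : ℝ≥0∞) ^ ((1 : ℝ) / d) * Metric.infEDist (cubeMap x r u) (S n)) (N : ℝ≥0∞))
        atTop := by
  classical
  have hd0 : (0 : ℝ) < d := by exact_mod_cast hd
  have hN0 : (0 : ℝ) < N := by exact_mod_cast hN
  set V : ℝ := (2 * r) ^ d with hV
  have hV0 : 0 < V := by positivity
  set q : ℝ := (μ (cubeAt x r)).toReal with hq
  have hq0 : 0 ≤ q := ENNReal.toReal_nonneg
  set B : ℝ := q / V + gridDensity d N with hB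
  have hB0 : 0 < B := add_pos_of_nonneg_of_pos (by positivity) (gridDensity_pos d hN)
  have hBeq : μ (cubeAt x r) / volume (cubeAt x r) + ENNReal.ofReal (gridDensity d N) =
      ENNReal.ofReal B := by
    rw [volume_cubeAt x hr.le, hB, ENNReal.ofReal_add (by positivity) (gridDensity_pos d hN).le,
      ENNReal.ofReal_div_of_pos hV0, hq, ENNReal.ofReal_toReal (measure_ne_top _ _)]
  have hqa : μ (cubeAt x r) < ENNReal.ofReal (q + V / N) := by
    rw [← ENNReal.ofReal_toReal (measure_ne_top μ (cubeAt x r)), ← hq]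
    exact (ENNReal.ofReal_lt_ofReal_iff (by positivity)).2 (lt_add_of_pos_right _ (by positivity))
  obtain ⟨η, hη0, hη⟩ := exists_measure_cubeAt_lt x r hqa
  have hcount := eventually_card_filter_le hS hconv (isClosed_cubeAt x (r + η)) hη
  have hp : Tendsto (fun n : ℕ => (n : ℝ) ^ ((1 : ℝ) / d)) atTop atTop :=
    (tendsto_rpow_atTop (by positivity)).comp tendsto_natCast_atTop_atTop
  have hm : Tendsto (fun n : ℕ => ⌊(n : ℝ) * (V * B)⌋₊) atTop atTop :=
    tendsto_nat_floor_atTop.comp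
      (tendsto_natCast_atTop_atTop.atTop_mul_const (by positivity))
  rw [hBeq]
  refine le_liminf_of_le (by isBoundedDefault) ?_
  filter_upwards [hcount, hm.eventually (eventually_le_of_lt_theta hc),
    hp.eventually_ge_atTop (N / η), hp.eventually_ge_atTop (N / (r * √d)),
    eventually_ge_atTop 1] with n hcnt htheta hp1 hp2 hn1
  set p : ℝ := (n : ℝ) ^ ((1 : ℝ) / d) with hpdef
  have hn0 : (0 : ℝ) < n := by exact_mod_cast hn1
  have hp0 : 0 < p := Real.rpow_pos_of_pos hn0 _
  have hpd : p ^ d = n := by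
    rw [hpdef, one_div]
    exact Real.rpow_inv_natCast_pow hn0.le (by lia)
  have hsd : 0 < √(d : ℝ) := Real.sqrt_pos.2 hd0
  set z : ℝ := 2 * r * √d * p / N with hz
  have hz2 : 2 ≤ z := by
    rw [div_le_iff₀ (by positivity)] at hp2
    rw [hz, le_div_iff₀ hN0]
    linarith
  have hzK : z ≤ ⌈z⌉₊ := Nat.le_ceil z
  have hKz : (⌈z⌉₊ : ℝ) < z + 1 := Nat.ceil_lt_add_one (by linarith)
  set K := ⌈z⌉₊
  have hK0 : (0 : ℝ) < K := by linarith
  have hK1 : 1 ≤ K := by exact_mod_cast hK0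
  have hmesh : p * (2 * r * (√d / K)) ≤ N := by
    rw [hz, div_le_iff₀ hN0] at hzK
    have : p * (2 * r * (√d / K)) = 2 * r * √d * p / K := by ring
    rw [this, div_le_iff₀ hK0]
    linarith
  have hmeshη : 2 * r * (√d / K) ≤ η := by
    rw [div_le_iff₀ hη0] at hp1
    exact le_of_mul_le_mul_left (by linarith) hp0
  obtain ⟨T, hT1, hT2, hT3, hT4⟩ := exists_competitor x hr hK1 hmeshη (S n)
  have hgrid : ((K : ℝ) + 1) ^ d ≤ n * (V * (2 * √d / N) ^ d) := by
    calc ((K : ℝ) + 1) ^ d ≤ (2 * z) ^ d := by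
          gcongr
          linarith
      _ = n * (V * (2 * √d / N) ^ d) := by
          rw [← hpd, hV, ← mul_pow, ← mul_pow, hz]
          ring
  have hTcard : T.card ≤ ⌊(n : ℝ) * (V * B)⌋₊ := by
    refine Nat.le_floor ?_
    have h1 : (T.card : ℝ) ≤ n * (q + V / N) + ((K : ℝ) + 1) ^ d := by
      have : (T.card : ℝ) ≤
          (((S n).filter (· ∈ cubeAt x (r + η))).card : ℝ) + ((K : ℝ) + 1) ^ d := by
        exact_mod_cast hT3
      linarith
    have h2 : n * (V * B) = n * (q + V / N) + n * (V * (2 * √d / N) ^ d) := by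
      rw [hB, gridDensity]
      field_simp
      ring
    linarith
  have hT := htheta T hT1 hT2 hTcard
  set I := ∫⁻ u in unitCube d, Metric.infEDist u (T : Set (EuclideanSpace ℝ (Fin d))) with hI
  have hnp : (n : ℝ≥0∞) ^ ((1 : ℝ) / d) = ENNReal.ofReal p := by
    rw [hpdef, ← ENNReal.ofReal_rpow_of_pos hn0, ENNReal.ofReal_natCast]
  have hlow : ENNReal.ofReal p * ENNReal.ofReal (2 * r) * I ≤ ∫⁻ u in unitCube d,
      min ((n : ℝ≥0∞) ^ ((1 : ℝ) / d) * Metric.infEDist (cubeMap x r u) (S n)) (N : ℝ≥0∞) := by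
    rw [hI, ← lintegral_const_mul _ measurable_infEDist]
    refine setLIntegral_mono' measurableSet_unitCube fun u hu => ?_
    have h := le_min_iff.1 (hT4 u hu)
    rw [hnp, mul_assoc]
    refine le_min (mul_le_mul_right h.1 _) ((mul_le_mul_right h.2 _).trans ?_)
    rw [← ENNReal.ofReal_mul hp0.le, ← ENNReal.ofReal_natCast]
    exact ENNReal.ofReal_le_ofReal hmesh
  refine le_trans ?_ hlow
  have hup : ((⌊(n : ℝ) * (V * B)⌋₊ : ℕ) : ℝ≥0∞) ^ ((1 : ℝ) / d) ≤
      ENNReal.ofReal p * ENNReal.ofReal (2 * r) * ENNReal.ofReal B ^ ((1 : ℝ) / d) := by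
    have hroot : V ^ ((1 : ℝ) / d) = 2 * r := by
      rw [hV, one_div]
      exact Real.pow_rpow_inv_natCast (by positivity) (by lia)
    calc ((⌊(n : ℝ) * (V * B)⌋₊ : ℕ) : ℝ≥0∞) ^ ((1 : ℝ) / d)
        ≤ ENNReal.ofReal ((n : ℝ) * (V * B)) ^ ((1 : ℝ) / d) := by
          gcongr
          rw [← ENNReal.ofReal_natCast]
          exact ENNReal.ofReal_le_ofReal (Nat.floor_le (by positivity))
      _ = _ := by
          rw [ENNReal.ofReal_rpow_of_pos (by positivity), ENNReal.ofReal_rpow_of_pos hB0,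
            Real.mul_rpow hn0.le (by positivity), Real.mul_rpow hV0.le hB0.le, hroot,
            ← ENNReal.ofReal_mul hp0.le, ← ENNReal.ofReal_mul (by positivity), ← hpdef,
            ← mul_assoc]
  have hBt : ENNReal.ofReal B ^ ((1 : ℝ) / d) ≠ ∞ := by simp [hd0.le]
  have hBz : ENNReal.ofReal B ^ ((1 : ℝ) / d) ≠ 0 := by simp [ENNReal.rpow_eq_zero_iff, hB0]
  rw [neg_div, ENNReal.rpow_neg, ← div_eq_mul_inv, ENNReal.div_le_iff hBz hBt]
  calc c ≤ _ := hT
    _ ≤ ENNReal.ofReal p * ENNReal.ofReal (2 * r) * ENNReal.ofReal B ^ ((1 : ℝ) / d) * I := by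
        gcongr
    _ = _ := by ring

end LocalBound

section Averaging

variable {d : ℕ}

lemma lintegral_mul_lintegral_cubeMap {φ h : EuclideanSpace ℝ (Fin d) → ℝ≥0∞}
    (hφ : Measurable φ) (hh : Measurable h) (r : ℝ) :
    ∫⁻ x, φ x * ∫⁻ u in unitCube d, h (cubeMap x r u) =
      ∫⁻ z, (∫⁻ u in unitCube d, φ (cubeMap z (-r) u)) * h z := by
  have hm := (continuous_cubeMap (d := d) r).measurable
  have hm' := (continuous_cubeMap (d := d) (-r)).measurable
  have h1 : ∀ x, φ x * ∫⁻ u in unitCube d, h (cubeMap x r u) =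
      ∫⁻ u in unitCube d, φ x * h (cubeMap x r u) := fun x =>
    (lintegral_const_mul _ (hh.comp (hm.comp measurable_prodMk_left))).symm
  have h2 : ∀ z, (∫⁻ u in unitCube d, φ (cubeMap z (-r) u)) * h z =
      ∫⁻ u in unitCube d, φ (cubeMap z (-r) u) * h z := fun z =>
    (lintegral_mul_const _ (hφ.comp (hm'.comp measurable_prodMk_left))).symm
  simp_rw [h1, h2]
  rw [lintegral_lintegral_swap (Measurable.aemeasurable
      ((hφ.comp measurable_fst).mul (hh.comp hm)))]
  conv_rhs => rw [lintegral_lintegral_swap (Measurable.aemeasurable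
      ((hφ.comp hm').mul (hh.comp measurable_fst)))]
  refine lintegral_congr fun u => ?_
  rw [← lintegral_add_right_eq_self (fun z => φ (cubeMap z (-r) u) * h z)
    (r • ((2 : ℝ) • u - WithLp.toLp 2 (fun _ => 1)))]
  refine lintegral_congr fun x => ?_
  simp [cubeMap]

lemma lintegral_lintegral_cubeMap {φ : EuclideanSpace ℝ (Fin d) → ℝ≥0∞}
    (hφ : Measurable φ) (r : ℝ) :
    ∫⁻ z, ∫⁻ u in unitCube d, φ (cubeMap z r u) = ∫⁻ x, φ x := by
  have h := lintegral_mul_lintegral_cubeMap hφ (measurable_const (a := (1 : ℝ≥0∞))) (-r)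
  simpa [volume_unitCube] using h.symm

lemma measurable_lintegral_cubeMap {φ : EuclideanSpace ℝ (Fin d) → ℝ≥0∞}
    (hφ : Measurable φ) (r : ℝ) :
    Measurable fun z => ∫⁻ u in unitCube d, φ (cubeMap z r u) :=
  Measurable.lintegral_prod_right' (hφ.comp (continuous_cubeMap r).measurable)

lemma tendsto_one_div_add_atTop_nhdsGT :
    Tendsto (fun k : ℕ => 1 / ((k : ℝ) + 1)) atTop (𝓝[>] 0) :=
  tendsto_nhdsWithin_iff.2 ⟨tendsto_one_div_add_atTop_nhds_zero_nat,
    Eventually.of_forall fun k => Set.mem_Ioi.2 (by positivity)⟩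

/-- Averages over small cubes converge from above in mean. -/
lemma tendsto_lintegral_average_sub {φ : EuclideanSpace ℝ (Fin d) → ℝ≥0∞}
    (hφ : Measurable φ) (hfin : ∫⁻ x, φ x ≠ ∞) :
    Tendsto (fun k : ℕ => ∫⁻ z, ((∫⁻ u in unitCube d,
      φ (cubeMap z (-(1 / ((k : ℝ) + 1))) u)) - φ z)) atTop (𝓝 0) := by
  set A : ℕ → EuclideanSpace ℝ (Fin d) → ℝ≥0∞ := fun k z =>
    ∫⁻ u in unitCube d, φ (cubeMap z (-(1 / ((k : ℝ) + 1))) u) with hA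
  have hAm : ∀ k, Measurable (A k) := fun k => measurable_lintegral_cubeMap hφ _
  have hAint : ∀ k, ∫⁻ z, A k z = ∫⁻ x, φ x := fun k => lintegral_lintegral_cubeMap hφ _
  have : IsFiniteMeasure (volume.withDensity φ) := isFiniteMeasure_withDensity hfin
  have hlim : ∀ᵐ z, Tendsto (fun k => A k z) atTop (𝓝 (φ z)) := by
    filter_upwards [ae_tendsto_div_cubeAt (volume.withDensity φ),
      Measure.rnDeriv_withDensity volume hφ] with z hz hz'
    rw [hz'] at hz
    refine (hz.comp tendsto_one_div_add_atTop_nhdsGT).congr fun k => ?_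
    have hk : (0 : ℝ) < 1 / ((k : ℝ) + 1) := by positivity
    simp only [hA, Function.comp_apply]
    rw [lintegral_cubeMap z (neg_ne_zero.2 hk.ne') hφ, abs_neg, abs_of_pos hk,
      withDensity_apply _ (isClosed_cubeAt z _).measurableSet]
  have hmin : Tendsto (fun k => ∫⁻ z, min (A k z) (φ z)) atTop (𝓝 (∫⁻ x, φ x)) := by
    refine tendsto_lintegral_of_dominated_convergence φ (fun k => (hAm k).min hφ)
      (fun k => Eventually.of_forall fun z => min_le_right _ _) hfin ?_
    filter_upwards [hlim] with z hz
    have h := hz.min (tendsto_const_nhds (x := φ z))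
    rwa [min_self] at h
  have hsub : ∀ k, ∫⁻ z, (A k z - φ z) = (∫⁻ x, φ x) - ∫⁻ z, min (A k z) (φ z) := by
    intro k
    rw [← hAint k, ← lintegral_sub ((hAm k).min hφ)
      (ne_top_of_le_ne_top hfin (lintegral_mono fun z => min_le_right _ _))
      (Eventually.of_forall fun z => min_le_left _ _)]
    exact lintegral_congr fun z => (tsub_min).symm
  refine Tendsto.congr (fun k => (hsub k).symm) ?_
  simpa using ENNReal.Tendsto.sub (tendsto_const_nhds (x := ∫⁻ x, φ x)) hmin (Or.inl hfin)

variable {S : ℕ → Finset (EuclideanSpace ℝ (Fin d))}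

/-- The rescaled distance to `S n`, truncated at level `N`. -/
noncomputable def truncDist (S : ℕ → Finset (EuclideanSpace ℝ (Fin d))) (n N : ℕ)
    (y : EuclideanSpace ℝ (Fin d)) : ℝ≥0∞ :=
  min ((n : ℝ≥0∞) ^ ((1 : ℝ) / d) * Metric.infEDist y (S n)) N

lemma measurable_truncDist (S : ℕ → Finset (EuclideanSpace ℝ (Fin d))) (n N : ℕ) :
    Measurable (truncDist S n N) :=
  (measurable_infEDist.const_mul _).min measurable_const

lemma lintegral_mul_liminf_average_le {φ : EuclideanSpace ℝ (Fin d) → ℝ≥0∞}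
    (hφ : Measurable φ) (N : ℕ) (r : ℝ) :
    ∫⁻ x, φ x * liminf (fun n => ∫⁻ u in unitCube d, truncDist S n N (cubeMap x r u)) atTop ≤
      liminf (fun n : ℕ => (n : ℝ≥0∞) ^ ((1 : ℝ) / d) *
        ∫⁻ x, φ x * Metric.infEDist x (S n)) atTop +
      N * ∫⁻ z, ((∫⁻ u in unitCube d, φ (cubeMap z (-r) u)) - φ z) := by
  set D := ∫⁻ z, ((∫⁻ u in unitCube d, φ (cubeMap z (-r) u)) - φ z)
  have hn : ∀ n, ∫⁻ x, φ x * ∫⁻ u in unitCube d, truncDist S n N (cubeMap x r u) ≤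
      (n : ℝ≥0∞) ^ ((1 : ℝ) / d) * (∫⁻ x, φ x * Metric.infEDist x (S n)) + N * D := by
    intro n
    have hm1 : Measurable fun x => φ x * Metric.infEDist x (S n) := hφ.mul measurable_infEDist
    have hm2 : Measurable fun z => (∫⁻ u in unitCube d, φ (cubeMap z (-r) u)) - φ z :=
      (measurable_lintegral_cubeMap hφ _).sub hφ
    rw [lintegral_mul_lintegral_cubeMap hφ (measurable_truncDist S n N),
      ← lintegral_const_mul _ hm1, ← lintegral_const_mul _ hm2,
      ← lintegral_add_left (hm1.const_mul _)]
    refine lintegral_mono fun z => ?_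
    have h1 : truncDist S n N z ≤ (n : ℝ≥0∞) ^ ((1 : ℝ) / d) * Metric.infEDist z (S n) :=
      min_le_left _ _
    have h2 : truncDist S n N z ≤ N := min_le_right _ _
    calc (∫⁻ u in unitCube d, φ (cubeMap z (-r) u)) * truncDist S n N z
        ≤ (φ z + ((∫⁻ u in unitCube d, φ (cubeMap z (-r) u)) - φ z)) * truncDist S n N z := by
          gcongr
          exact le_add_tsub
      _ ≤ φ z * ((n : ℝ≥0∞) ^ ((1 : ℝ) / d) * Metric.infEDist z (S n)) +
          ((∫⁻ u in unitCube d, φ (cubeMap z (-r) u)) - φ z) * N := by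
          rw [add_mul]
          gcongr
      _ = _ := by ring
  calc ∫⁻ x, φ x * liminf (fun n => ∫⁻ u in unitCube d, truncDist S n N (cubeMap x r u)) atTop
      ≤ ∫⁻ x, liminf (fun n => φ x *
          ∫⁻ u in unitCube d, truncDist S n N (cubeMap x r u)) atTop := by
        refine lintegral_mono fun x => ?_
        have h := ENNReal.le_liminf_mul (f := (atTop : Filter ℕ)) (u := fun _ => φ x)
          (v := fun n => ∫⁻ u in unitCube d, truncDist S n N (cubeMap x r u))
        rwa [liminf_const] at h
    _ ≤ liminf (fun n => ∫⁻ x, φ x *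
          ∫⁻ u in unitCube d, truncDist S n N (cubeMap x r u)) atTop :=
        lintegral_liminf_le fun n =>
          hφ.mul (measurable_lintegral_cubeMap (measurable_truncDist S n N) r)
    _ ≤ liminf (fun n : ℕ => (n : ℝ≥0∞) ^ ((1 : ℝ) / d) *
          (∫⁻ x, φ x * Metric.infEDist x (S n)) + N * D) atTop :=
        liminf_le_liminf (Eventually.of_forall hn)
    _ = _ := liminf_add_const _ _ _ (by isBoundedDefault) (by isBoundedDefault)

/-- The lower bound for a general density, in terms of the Radon-Nikodym derivative of the
limit of the empirical measures. -/
lemma mul_lintegral_rnDeriv_le_liminf (hd : 1 ≤ d) {c : ℝ≥0∞} (hc : c < theta d)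
    (hS : ∀ n, 1 ≤ n → (S n).Nonempty ∧ (S n).card ≤ n)
    {μ : Measure (EuclideanSpace ℝ (Fin d))} [IsProbabilityMeasure μ]
    (hconv : ∀ g : BoundedContinuousFunction (EuclideanSpace ℝ (Fin d)) ℝ,
      Tendsto (fun n => ∫ x, g x ∂(empMeasure (S n))) atTop (𝓝 (∫ x, g x ∂μ)))
    {φ : EuclideanSpace ℝ (Fin d) → ℝ≥0∞} (hφ : Measurable φ) (hfin : ∫⁻ x, φ x ≠ ∞) :
    c * ∫⁻ x, φ x * μ.rnDeriv volume x ^ (-(1 : ℝ) / d) ≤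
      liminf (fun n : ℕ => (n : ℝ≥0∞) ^ ((1 : ℝ) / d) *
        ∫⁻ x, φ x * Metric.infEDist x (S n)) atTop := by
  set L := liminf (fun n : ℕ => (n : ℝ≥0∞) ^ ((1 : ℝ) / d) *
        ∫⁻ x, φ x * Metric.infEDist x (S n)) atTop
  have hg := Measure.measurable_rnDeriv μ volume
  have hmeas : ∀ N : ℕ, Measurable fun x => φ x * (c * (μ.rnDeriv volume x +
      ENNReal.ofReal (gridDensity d N)) ^ (-(1 : ℝ) / d)) := fun N =>
    hφ.mul (((hg.add_const _).pow_const _).const_mul _)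
  have hN : ∀ N : ℕ, 1 ≤ N → ∫⁻ x, φ x * (c * (μ.rnDeriv volume x +
      ENNReal.ofReal (gridDensity d N)) ^ (-(1 : ℝ) / d)) ≤ L := by
    intro N hN1
    set H : ℕ → EuclideanSpace ℝ (Fin d) → ℝ≥0∞ := fun k x =>
      liminf (fun n => ∫⁻ u in unitCube d,
        truncDist S n N (cubeMap x (1 / ((k : ℝ) + 1)) u)) atTop with hH
    have hHm : ∀ k, Measurable (H k) := fun k =>
      Measurable.liminf fun n => measurable_lintegral_cubeMap (measurable_truncDist S n N) _
    calc _ ≤ ∫⁻ x, liminf (fun k => φ x * H k x) atTop := by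
          refine lintegral_mono_ae ?_
          filter_upwards [ae_tendsto_div_cubeAt μ] with x hx
          have h1 : Tendsto (fun k : ℕ => c * (μ (cubeAt x (1 / ((k : ℝ) + 1))) /
              volume (cubeAt x (1 / ((k : ℝ) + 1))) +
              ENNReal.ofReal (gridDensity d N)) ^ (-(1 : ℝ) / d)) atTop
              (𝓝 (c * (μ.rnDeriv volume x +
                ENNReal.ofReal (gridDensity d N)) ^ (-(1 : ℝ) / d))) :=
            ENNReal.Tendsto.const_mul ((ENNReal.continuous_rpow_const.tendsto _).comp
              ((hx.comp tendsto_one_div_add_atTop_nhdsGT).add_const _)) (Or.inr hc.ne_top)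
          have h2 : c * (μ.rnDeriv volume x +
              ENNReal.ofReal (gridDensity d N)) ^ (-(1 : ℝ) / d) ≤
              liminf (fun k => H k x) atTop := by
            rw [← h1.liminf_eq]
            exact liminf_le_liminf (Eventually.of_forall fun k =>
              le_liminf_lintegral_min hd hc hS hconv x (by positivity) hN1)
          have h3 := ENNReal.le_liminf_mul (f := (atTop : Filter ℕ)) (u := fun _ => φ x)
            (v := fun k => H k x)
          rw [liminf_const] at h3
          exact (mul_le_mul_right h2 _).trans h3
      _ ≤ liminf (fun k => ∫⁻ x, φ x * H k x) atTop :=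
          lintegral_liminf_le fun k => hφ.mul (hHm k)
      _ ≤ liminf (fun k : ℕ => L + N * ∫⁻ z, ((∫⁻ u in unitCube d,
            φ (cubeMap z (-(1 / ((k : ℝ) + 1))) u)) - φ z)) atTop :=
          liminf_le_liminf (Eventually.of_forall fun k =>
            lintegral_mul_liminf_average_le hφ N _)
      _ = L := by
          have h := (ENNReal.Tendsto.const_mul (a := (N : ℝ≥0∞))
            (tendsto_lintegral_average_sub hφ hfin) (Or.inr (by simp))).const_add L
          rw [mul_zero, add_zero] at h
          exact h.liminf_eq
  have hφfin : ∀ᵐ x, φ x < ∞ := ae_lt_top hφ hfin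
  have hm : Measurable fun x => φ x * μ.rnDeriv volume x ^ (-(1 : ℝ) / d) :=
    hφ.mul (hg.pow_const _)
  rw [← lintegral_const_mul _ hm]
  calc _ ≤ ∫⁻ x, liminf (fun N : ℕ => φ x * (c * (μ.rnDeriv volume x +
        ENNReal.ofReal (gridDensity d N)) ^ (-(1 : ℝ) / d))) atTop := by
        refine lintegral_mono_ae ?_
        filter_upwards [hφfin] with x hx
        have h0 : Tendsto (fun N : ℕ => μ.rnDeriv volume x +
            ENNReal.ofReal (gridDensity d N)) atTop (𝓝 (μ.rnDeriv volume x)) := by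
          simpa using (ENNReal.tendsto_ofReal (tendsto_gridDensity hd)).const_add
            (μ.rnDeriv volume x)
        have h1 := ENNReal.Tendsto.const_mul (a := φ x) (ENNReal.Tendsto.const_mul (a := c)
          ((ENNReal.continuous_rpow_const (y := -(1 : ℝ) / d)).tendsto _ |>.comp h0)
          (Or.inr hc.ne_top)) (Or.inr hx.ne)
        rw [mul_left_comm]
        exact h1.liminf_eq.ge
    _ ≤ liminf (fun N : ℕ => ∫⁻ x, φ x * (c * (μ.rnDeriv volume x +
        ENNReal.ofReal (gridDensity d N)) ^ (-(1 : ℝ) / d))) atTop := lintegral_liminf_le hmeas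
    _ ≤ L := liminf_le_of_frequently_le'
        ((eventually_ge_atTop 1).mono fun N h => hN N h).frequently

end Averaging

theorem stmt1 (d : ℕ) (hd : 1 ≤ d) (Ω : Set (EuclideanSpace ℝ (Fin d)))
    (hΩc : IsCompact Ω) (hΩconv : Convex ℝ Ω) (hΩint : (interior Ω).Nonempty)
    (f : EuclideanSpace ℝ (Fin d) → ℝ) (hf0 : ∀ x, 0 ≤ f x) (hfint : IntegrableOn f Ω)
    (ν : Measure (EuclideanSpace ℝ (Fin d)))
    (hν : ν = (volume.restrict Ω).withDensity (fun x => ENNReal.ofReal (f x)))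
    (hνP : IsProbabilityMeasure ν)
    (Sn : ℕ → Finset (EuclideanSpace ℝ (Fin d)))
    (hSn : ∀ n : ℕ, 1 ≤ n → (Sn n : Set (EuclideanSpace ℝ (Fin d))) ⊆ Ω ∧
      (Sn n).Nonempty ∧ (Sn n).card ≤ n)
    (μ : Measure (EuclideanSpace ℝ (Fin d))) (hμP : IsProbabilityMeasure μ) (hμΩ : μ Ωᶜ = 0)
    (hconv : ∀ g : BoundedContinuousFunction (EuclideanSpace ℝ (Fin d)) ℝ,
      Tendsto (fun n : ℕ => ∫ x, g x ∂(empMeasure (Sn n))) atTop (𝓝 (∫ x, g x ∂μ)))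
    (ρ : EuclideanSpace ℝ (Fin d) → ℝ) (hρ0 : ∀ x, 0 ≤ ρ x) (hρint : IntegrableOn ρ Ω)
    (μsing : Measure (EuclideanSpace ℝ (Fin d))) (hsing : μsing ⟂ₘ volume)
    (hdec : μ = (volume.restrict Ω).withDensity (fun x => ENNReal.ofReal (ρ x)) + μsing) :
    theta d * ∫⁻ x in Ω, ENNReal.ofReal (f x) * ENNReal.ofReal (ρ x) ^ (-(1 : ℝ) / d) ≤
      Filter.liminf (fun n : ℕ => (n : ℝ≥0∞) ^ ((1 : ℝ) / d) *
        ENNReal.ofReal (avgDist Ω ν (Sn n))) atTop := by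
  have hΩ := hΩc.measurableSet
  set f' : EuclideanSpace ℝ (Fin d) → ℝ≥0∞ := fun x => ENNReal.ofReal (f x)
  have hf' : AEMeasurable f' (volume.restrict Ω) := hfint.1.aemeasurable.ennreal_ofReal
  set φ : EuclideanSpace ℝ (Fin d) → ℝ≥0∞ := Ω.indicator (hf'.mk f') with hφdef
  have hφ : Measurable φ := hf'.measurable_mk.indicator hΩ
  have hφmul : ∀ w : EuclideanSpace ℝ (Fin d) → ℝ≥0∞,
      ∫⁻ x, φ x * w x = ∫⁻ x in Ω, f' x * w x := by
    intro w
    simp_rw [hφdef, ← Set.indicator_mul_left]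
    rw [lintegral_indicator hΩ]
    refine lintegral_congr_ae ?_
    filter_upwards [hf'.ae_eq_mk] with x hx
    rw [hx]
  have hfin : ∫⁻ x, φ x ≠ ∞ := by
    have h := hφmul fun _ => 1
    simp only [mul_one] at h
    rw [h]
    exact hfint.lintegral_lt_top.ne
  have hdist : ∀ n : ℕ, 1 ≤ n → ∫⁻ x, φ x * Metric.infEDist x (Sn n) =
      ENNReal.ofReal (avgDist Ω ν (Sn n)) := by
    intro n hn
    have hne : (Sn n : Set (EuclideanSpace ℝ (Fin d))).Nonempty :=
      Finset.coe_nonempty.2 (hSn n hn).2.1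
    have hint : IntegrableOn
        (fun x => Metric.infDist x (Sn n : Set (EuclideanSpace ℝ (Fin d)))) Ω ν :=
      (Metric.continuous_infDist_pt _).continuousOn.integrableOn_compact hΩc
    have hνΩ : ν.restrict Ω = (volume.restrict Ω).withDensity f' := by
      rw [hν, restrict_withDensity hΩ, Measure.restrict_restrict hΩ, Set.inter_self]
    rw [avgDist, ofReal_integral_eq_lintegral_ofReal hint
      (Eventually.of_forall fun x => Metric.infDist_nonneg), hνΩ,
      lintegral_withDensity_eq_lintegral_mul₀ hf'
        (Metric.continuous_infDist_pt _).measurable.ennreal_ofReal.aemeasurable, hφmul]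
    refine lintegral_congr fun x => ?_
    simp only [Pi.mul_apply, Metric.infDist]
    rw [ENNReal.ofReal_toReal (Metric.infEDist_ne_top hne)]
  have hρ : AEMeasurable (fun x => ENNReal.ofReal (ρ x)) (volume.restrict Ω) :=
    hρint.1.aemeasurable.ennreal_ofReal
  have hrn : Ω.indicator (fun x => ENNReal.ofReal (ρ x)) =ᵐ[volume] μ.rnDeriv volume :=
    Measure.eq_rnDeriv₀ ((aemeasurable_indicator_iff hΩ).2 hρ) hsing (by
      rw [withDensity_indicator hΩ, hdec, add_comm])
  have hrhs : ∫⁻ x in Ω, f' x * ENNReal.ofReal (ρ x) ^ (-(1 : ℝ) / d) =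
      ∫⁻ x, φ x * μ.rnDeriv volume x ^ (-(1 : ℝ) / d) := by
    rw [hφmul]
    refine lintegral_congr_ae ?_
    filter_upwards [ae_restrict_of_ae hrn, ae_restrict_mem hΩ] with x hx hxΩ
    rw [← hx, Set.indicator_of_mem hxΩ]
  have hlim : liminf (fun n : ℕ => (n : ℝ≥0∞) ^ ((1 : ℝ) / d) *
      ENNReal.ofReal (avgDist Ω ν (Sn n))) atTop = liminf (fun n : ℕ =>
        (n : ℝ≥0∞) ^ ((1 : ℝ) / d) * ∫⁻ x, φ x * Metric.infEDist x (Sn n)) atTop := by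
    refine liminf_congr ?_
    filter_upwards [eventually_ge_atTop 1] with n hn
    rw [hdist n hn]
  rw [hlim, hrhs]
  refine ENNReal.mul_le_of_forall_lt fun c hc b hb => ?_
  exact (mul_le_mul_right hb.le c).trans (mul_lintegral_rnDeriv_le_liminf hd hc
    (fun n hn => (hSn n hn).2) hconv hφ hfin)
end

section
/- Let Ω ⊂ ℝ^d be a compact set with positive Lebesgue measure and f ∈ L¹(Ω) with f ≥ 0 and ∫_Ω f dx = 1. Then over all Borel probability measures μ on Ω, written as μ = ρ·𝓛^d + μ_sing with μ_sing singular with respect to 𝓛^d, the functional μ ↦ ∫_Ω f(x) ρ(x)^{-1/d} dx (with the integrand interpreted as +∞ where f > 0 and ρ = 0) attains its minimum value (∫_Ω f(x)^{d/(d+1)} dx)^{(d+1)/d}, and the unique minimizer is the absolutely continuous measure μ̄ = c f^{d/(d+1)}·𝓛^d with c := (∫_Ω f(x)^{d/(d+1)} dx)^{-1}. -/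
open MeasureTheory Filter Topology ENNReal

/-- The functional `μ ↦ ∫_Ω f ρ^{-1/d} dx` evaluated on the density `ρ` of the absolutely
continuous part of `μ`; in `ℝ≥0∞` the integrand is `+∞` where `f > 0` and `ρ = 0`. -/
noncomputable def distortion (d : ℕ) (Ω : Set (EuclideanSpace ℝ (Fin d)))
    (f ρ : EuclideanSpace ℝ (Fin d) → ℝ) : ℝ≥0∞ :=
  ∫⁻ x in Ω, ENNReal.ofReal (f x) * ENNReal.ofReal (ρ x) ^ (-(1 : ℝ) / d)

/-- The measure `μ̄ = c f^{d/(d+1)}·𝓛^d` on `Ω`, with `c = (∫_Ω f^{d/(d+1)} dx)⁻¹`. -/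
noncomputable def muBar (d : ℕ) (Ω : Set (EuclideanSpace ℝ (Fin d)))
    (f : EuclideanSpace ℝ (Fin d) → ℝ) : Measure (EuclideanSpace ℝ (Fin d)) :=
  (volume.restrict Ω).withDensity (fun x => ENNReal.ofReal
    ((∫ y in Ω, f y ^ ((d : ℝ) / ((d : ℝ) + 1)))⁻¹ * f x ^ ((d : ℝ) / ((d : ℝ) + 1))))

/-- The tangent line at `1` of the strictly convex function `t ↦ t ^ (-α)` lies below it, strictly
so away from `1`. -/
lemma one_add_lt_rpow_neg_add_mul {α t : ℝ} (hα : 0 < α) (ht : 0 < t) (ht1 : t ≠ 1) :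
    1 + α < t ^ (-α) + α * t := by
  have hlog : Real.log t ≠ 0 := Real.log_ne_zero_of_pos_of_ne_one ht ht1
  have h1 := Real.add_one_lt_exp (x := Real.log t * -α) (by simp [hlog, hα.ne'])
  have h2 := mul_lt_mul_of_pos_left (Real.add_one_lt_exp hlog) hα
  rw [Real.exp_log ht] at h2
  rw [Real.rpow_def_of_pos ht]
  linarith

lemma ofReal_lt_ofReal_mul_rpow_neg_add {α L f r ρ : ℝ} (hα : 0 < α) (hL : 0 < L)
    (hf : 0 ≤ f) (hρ : 0 ≤ ρ) (hpos : 0 < f → 0 < r ∧ f * r ^ (-α) = L * r)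
    (hzero : f = 0 → r = 0) (hne : ρ ≠ r) :
    ENNReal.ofReal (L * (1 + α) * r) <
      ENNReal.ofReal f * ENNReal.ofReal ρ ^ (-α) + ENNReal.ofReal (L * α * ρ) := by
  rcases hf.eq_or_lt with rfl | hf
  · obtain rfl := hzero rfl
    have : 0 < ρ := hρ.lt_of_ne' hne
    simp only [mul_zero, ENNReal.ofReal_zero, zero_mul, zero_add, ENNReal.ofReal_pos]
    positivity
  obtain ⟨hr, hfr⟩ := hpos hf
  rcases hρ.eq_or_lt with rfl | hρ
  · rw [ENNReal.ofReal_zero, ENNReal.zero_rpow_of_neg (neg_neg_of_pos hα),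
      ENNReal.mul_top (by simpa using hf), top_add]
    exact ENNReal.ofReal_lt_top
  rw [ENNReal.ofReal_rpow_of_pos hρ, ← ENNReal.ofReal_mul hf.le,
    ← ENNReal.ofReal_add (by positivity) (by positivity),
    ENNReal.ofReal_lt_ofReal_iff (by positivity)]
  have key := mul_lt_mul_of_pos_left (one_add_lt_rpow_neg_add_mul hα (div_pos hρ hr)
    (fun h => hne ((div_eq_one_iff_eq hr.ne').1 h))) (mul_pos hL hr)
  calc L * (1 + α) * r = L * r * (1 + α) := by ring
    _ < L * r * ((ρ / r) ^ (-α) + α * (ρ / r)) := key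
    _ = f * r ^ (-α) * (ρ / r) ^ (-α) + L * α * ρ := by
      rw [hfr]; field_simp
    _ = f * ρ ^ (-α) + L * α * ρ := by
      rw [mul_assoc f, ← Real.mul_rpow hr.le (by positivity), mul_div_cancel₀ _ hr.ne']

lemma ofReal_mul_rpow_neg_self {α L f r : ℝ} (hf : 0 ≤ f)
    (hpos : 0 < f → 0 < r ∧ f * r ^ (-α) = L * r) (hzero : f = 0 → r = 0) :
    ENNReal.ofReal f * ENNReal.ofReal r ^ (-α) = ENNReal.ofReal (L * r) := by
  rcases hf.eq_or_lt with rfl | hf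
  · simp [hzero rfl]
  obtain ⟨hr, hfr⟩ := hpos hf
  rw [ENNReal.ofReal_rpow_of_pos hr, ← ENNReal.ofReal_mul hf.le, hfr]

section Minimization

variable {X : Type*} [MeasurableSpace X] {ν : Measure X} {f r ρ : X → ℝ} {α L : ℝ}

lemma lintegral_ofReal_mul_of_integral_eq_one {C : ℝ} (hC : 0 ≤ C) (hr0 : ∀ x, 0 ≤ r x)
    (hr : Integrable r ν) (hr1 : ∫ x, r x ∂ν = 1) :
    ∫⁻ x, ENNReal.ofReal (C * r x) ∂ν = ENNReal.ofReal C := by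
  rw [← ofReal_integral_eq_lintegral_ofReal (hr.const_mul C)
    (ae_of_all _ fun x => mul_nonneg hC (hr0 x)), integral_const_mul, hr1, mul_one]

/-- If the density `r` of total mass one satisfies the Euler-Lagrange equation
`f * r ^ (-α) = L * r`, then `L` bounds `ρ ↦ ∫⁻ f * ρ ^ (-α)` from below on densities of mass at
most one, with equality only at `r`. -/
lemma le_lintegral_mul_rpow_neg_and_ae_eq (hα : 0 < α) (hL : 0 < L) (hf0 : ∀ x, 0 ≤ f x)
    (hρ0 : ∀ x, 0 ≤ ρ x) (hr0 : ∀ x, 0 ≤ r x)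
    (hpos : ∀ x, 0 < f x → 0 < r x ∧ f x * r x ^ (-α) = L * r x)
    (hzero : ∀ x, f x = 0 → r x = 0) (hf : AEMeasurable f ν) (hρ : AEMeasurable ρ ν)
    (hr : Integrable r ν) (hr1 : ∫ x, r x ∂ν = 1) (hρ1 : ∫⁻ x, ENNReal.ofReal (ρ x) ∂ν ≤ 1) :
    ENNReal.ofReal L ≤ ∫⁻ x, ENNReal.ofReal (f x) * ENNReal.ofReal (ρ x) ^ (-α) ∂ν ∧
      (∫⁻ x, ENNReal.ofReal (f x) * ENNReal.ofReal (ρ x) ^ (-α) ∂ν = ENNReal.ofReal L →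
        ρ =ᵐ[ν] r) := by
  set J := ∫⁻ x, ENNReal.ofReal (f x) * ENNReal.ofReal (ρ x) ^ (-α) ∂ν with hJ
  have hstrict : ∀ x, ρ x ≠ r x → ENNReal.ofReal (L * (1 + α) * r x) <
      ENNReal.ofReal (f x) * ENNReal.ofReal (ρ x) ^ (-α) + ENNReal.ofReal (L * α * ρ x) :=
    fun x => ofReal_lt_ofReal_mul_rpow_neg_add hα hL (hf0 x) (hρ0 x) (hpos x) (hzero x)
  have hle : ∀ x, ENNReal.ofReal (L * (1 + α) * r x) ≤
      ENNReal.ofReal (f x) * ENNReal.ofReal (ρ x) ^ (-α) + ENNReal.ofReal (L * α * ρ x) := by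
    intro x
    by_cases h : ρ x = r x
    · rw [h, ofReal_mul_rpow_neg_self (hf0 x) (hpos x) (hzero x),
        ← ENNReal.ofReal_add (mul_nonneg hL.le (hr0 x))
          (mul_nonneg (mul_nonneg hL.le hα.le) (hr0 x))]
      exact (congrArg ENNReal.ofReal (by ring)).le
    · exact (hstrict x h).le
  have hleft : ∫⁻ x, ENNReal.ofReal (L * (1 + α) * r x) ∂ν =
      ENNReal.ofReal L + ENNReal.ofReal (L * α) := by
    rw [lintegral_ofReal_mul_of_integral_eq_one (by positivity) hr0 hr hr1,
      ← ENNReal.ofReal_add (by positivity) (by positivity)]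
    congr 1
    ring
  have hright : ∫⁻ x, (ENNReal.ofReal (f x) * ENNReal.ofReal (ρ x) ^ (-α) +
      ENNReal.ofReal (L * α * ρ x)) ∂ν ≤ J + ENNReal.ofReal (L * α) := by
    rw [lintegral_add_right' _ (hρ.const_mul (L * α)).ennreal_ofReal, ← hJ]
    gcongr
    simp_rw [ENNReal.ofReal_mul (mul_nonneg hL.le hα.le)]
    rw [lintegral_const_mul' _ _ ENNReal.ofReal_ne_top]
    exact mul_le_of_le_one_right' hρ1
  refine ⟨?_, fun hJL => ?_⟩
  · have h := (hleft.symm.trans_le (lintegral_mono hle)).trans hright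
    exact (ENNReal.add_le_add_iff_right ENNReal.ofReal_ne_top).1 h
  · have hae := ae_eq_of_ae_le_of_lintegral_le (ae_of_all ν hle)
      (by rw [hleft]; finiteness)
      ((hf.ennreal_ofReal.mul (hρ.ennreal_ofReal.pow_const _)).add
        (hρ.const_mul (L * α)).ennreal_ofReal)
      (by rw [hleft, ← hJL]; exact hright)
    filter_upwards [hae] with x hx
    by_contra h
    exact (hstrict x h).ne hx

lemma MeasureTheory.Integrable.rpow_of_le_one [IsFiniteMeasure ν] {p : ℝ} (hf : Integrable f ν)
    (hf0 : ∀ x, 0 ≤ f x) (hp0 : 0 ≤ p) (hp1 : p ≤ 1) : Integrable (fun x => f x ^ p) ν := by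
  refine ((integrable_const (1 : ℝ)).add hf).mono'
    (hf.aemeasurable.pow_const p).aestronglyMeasurable (ae_of_all _ fun x => ?_)
  rw [Real.norm_of_nonneg (Real.rpow_nonneg (hf0 x) p), Pi.add_apply]
  rcases le_total (f x) 1 with h | h
  · linarith [Real.rpow_le_one (hf0 x) h hp0, hf0 x]
  · linarith [Real.rpow_le_self_of_one_le h hp1]

lemma integral_rpow_pos_of_integral_pos {p : ℝ} (hf0 : ∀ x, 0 ≤ f x) (hp : p ≠ 0)
    (hfp : Integrable (fun x => f x ^ p) ν) (hf : 0 < ∫ x, f x ∂ν) : 0 < ∫ x, f x ^ p ∂ν := by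
  have h0 : ∀ x, 0 ≤ f x ^ p := fun x => Real.rpow_nonneg (hf0 x) p
  refine (integral_nonneg h0).lt_of_ne' fun h => hf.ne' ?_
  refine integral_eq_zero_of_ae ?_
  filter_upwards [(integral_eq_zero_iff_of_nonneg h0 hfp).1 h] with x hx
  exact (Real.rpow_eq_zero (hf0 x) hp).1 hx

end Minimization

lemma mul_rpow_neg_inv_eq {d I y : ℝ} (hd : 0 < d) (hI : 0 < I) (hy : 0 < y) :
    y * (I⁻¹ * y ^ (d / (d + 1))) ^ (-(1 / d)) =
      I ^ ((d + 1) / d) * (I⁻¹ * y ^ (d / (d + 1))) := by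
  have h1 : y ^ (d / (d + 1)) = y * (y ^ (d / (d + 1))) ^ (-(1 / d)) := by
    rw [← Real.rpow_mul hy.le]
    nth_rewrite 2 [← Real.rpow_one y]
    rw [← Real.rpow_add hy]
    congr 1
    field_simp
    ring
  have h2 : I⁻¹ ^ (-(1 / d)) = I ^ ((d + 1) / d) * I⁻¹ := by
    rw [Real.inv_rpow hI.le, ← Real.rpow_neg hI.le, neg_neg, ← Real.rpow_neg_one I,
      ← Real.rpow_add hI]
    congr 1
    field_simp
    ring
  rw [Real.mul_rpow (by positivity) (by positivity), h2]
  linear_combination -(I ^ ((d + 1) / d) * I⁻¹) * h1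

theorem stmt5 (d : ℕ) (hd : 1 ≤ d) (Ω : Set (EuclideanSpace ℝ (Fin d)))
    (hΩc : IsCompact Ω) (hΩpos : 0 < volume Ω)
    (f : EuclideanSpace ℝ (Fin d) → ℝ) (hf0 : ∀ x, 0 ≤ f x) (hfint : IntegrableOn f Ω)
    (hf1 : ∫ x in Ω, f x = 1) :
    -- the functional is bounded below by `(∫_Ω f^{d/(d+1)})^{(d+1)/d}` ...
    (∀ (μ : Measure (EuclideanSpace ℝ (Fin d))), IsProbabilityMeasure μ → μ Ωᶜ = 0 →
      ∀ (ρ : EuclideanSpace ℝ (Fin d) → ℝ), (∀ x, 0 ≤ ρ x) → IntegrableOn ρ Ω →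
        ∀ (μsing : Measure (EuclideanSpace ℝ (Fin d))), μsing ⟂ₘ volume →
          μ = volume.withDensity (fun x => ENNReal.ofReal (ρ x)) + μsing →
          ENNReal.ofReal
              ((∫ x in Ω, f x ^ ((d : ℝ) / ((d : ℝ) + 1))) ^ (((d : ℝ) + 1) / (d : ℝ))) ≤
            distortion d Ω f ρ) ∧
    -- ... the bound is attained by `μ̄ = c f^{d/(d+1)}·𝓛^d`, which is admissible ...
    (IsProbabilityMeasure (muBar d Ω f) ∧ (muBar d Ω f) Ωᶜ = 0 ∧
      distortion d Ω f (fun x =>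
          (∫ y in Ω, f y ^ ((d : ℝ) / ((d : ℝ) + 1)))⁻¹ * f x ^ ((d : ℝ) / ((d : ℝ) + 1))) =
        ENNReal.ofReal
          ((∫ x in Ω, f x ^ ((d : ℝ) / ((d : ℝ) + 1))) ^ (((d : ℝ) + 1) / (d : ℝ)))) ∧
    -- ... and `μ̄` is the unique minimizer.
    (∀ (μ : Measure (EuclideanSpace ℝ (Fin d))), IsProbabilityMeasure μ → μ Ωᶜ = 0 →
      ∀ (ρ : EuclideanSpace ℝ (Fin d) → ℝ), (∀ x, 0 ≤ ρ x) → IntegrableOn ρ Ω →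
        ∀ (μsing : Measure (EuclideanSpace ℝ (Fin d))), μsing ⟂ₘ volume →
          μ = volume.withDensity (fun x => ENNReal.ofReal (ρ x)) + μsing →
          distortion d Ω f ρ =
            ENNReal.ofReal
              ((∫ x in Ω, f x ^ ((d : ℝ) / ((d : ℝ) + 1))) ^ (((d : ℝ) + 1) / (d : ℝ))) →
          μ = muBar d Ω f) := by
  have hd0 : (0 : ℝ) < d := by exact_mod_cast hd
  have hp0 : 0 < (d : ℝ) / ((d : ℝ) + 1) := by positivity
  have hp1 : (d : ℝ) / ((d : ℝ) + 1) ≤ 1 := (div_le_one (by positivity)).2 (by linarith)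
  have hΩm : MeasurableSet Ω := hΩc.measurableSet
  have : IsFiniteMeasure (volume.restrict Ω) := ⟨by simpa using hΩc.measure_lt_top⟩
  have hfp : Integrable (fun x => f x ^ ((d : ℝ) / ((d : ℝ) + 1))) (volume.restrict Ω) :=
    hfint.rpow_of_le_one hf0 hp0.le hp1
  have hI := integral_rpow_pos_of_integral_pos hf0 hp0.ne' hfp (by rw [hf1]; exact one_pos)
  simp only [distortion, muBar, neg_div]
  set I := ∫ x in Ω, f x ^ ((d : ℝ) / ((d : ℝ) + 1))
  set r : EuclideanSpace ℝ (Fin d) → ℝ := fun x => I⁻¹ * f x ^ ((d : ℝ) / ((d : ℝ) + 1)) with hrdef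
  have hL : 0 < I ^ (((d : ℝ) + 1) / d) := Real.rpow_pos_of_pos hI _
  have hr0 : ∀ x, 0 ≤ r x := fun x => mul_nonneg (inv_nonneg.2 hI.le) (Real.rpow_nonneg (hf0 x) _)
  have hr : Integrable r (volume.restrict Ω) := hfp.const_mul _
  have hr1 : ∫ x in Ω, r x = 1 := by
    rw [hrdef, integral_const_mul]
    exact inv_mul_cancel₀ hI.ne'
  have hpos : ∀ x, 0 < f x →
      0 < r x ∧ f x * r x ^ (-(1 / (d : ℝ))) = I ^ (((d : ℝ) + 1) / d) * r x := fun x hx =>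
    ⟨mul_pos (inv_pos.2 hI) (Real.rpow_pos_of_pos hx _), mul_rpow_neg_inv_eq hd0 hI hx⟩
  have hzero : ∀ x, f x = 0 → r x = 0 := fun x hx => by
    simp only [hrdef, hx, Real.zero_rpow hp0.ne', mul_zero]
  have hmass : ∫⁻ x in Ω, ENNReal.ofReal (r x) = 1 := by
    simpa using lintegral_ofReal_mul_of_integral_eq_one zero_le_one hr0 hr hr1
  have hdecomp : ∀ μ : Measure (EuclideanSpace ℝ (Fin d)), IsProbabilityMeasure μ → μ Ωᶜ = 0 →
      ∀ (ρ : EuclideanSpace ℝ (Fin d) → ℝ) (μsing : Measure (EuclideanSpace ℝ (Fin d))),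
        μ = volume.withDensity (fun x => ENNReal.ofReal (ρ x)) + μsing →
          (∫⁻ x in Ω, ENNReal.ofReal (ρ x)) + μsing Ω = 1 := by
    intro μ hμ hμΩ ρ μsing h
    rw [← withDensity_apply _ hΩm, ← Measure.add_apply, ← h]
    exact (prob_compl_eq_zero_iff hΩm).1 hμΩ
  have hmin := fun (ρ : EuclideanSpace ℝ (Fin d) → ℝ) (hρ0 : ∀ x, 0 ≤ ρ x)
      (hρ : IntegrableOn ρ Ω) =>
    le_lintegral_mul_rpow_neg_and_ae_eq (one_div_pos.2 hd0) hL hf0 hρ0 hr0 hpos hzero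
      hfint.aemeasurable hρ.aemeasurable hr hr1
  refine ⟨?_, ⟨⟨?_⟩, ?_, ?_⟩, ?_⟩
  · intro μ hμ hμΩ ρ hρ0 hρ μsing _ h
    exact (hmin ρ hρ0 hρ (le_self_add.trans (hdecomp μ hμ hμΩ ρ μsing h).le)).1
  · rw [withDensity_apply _ MeasurableSet.univ, setLIntegral_univ, hmass]
  · rw [withDensity_apply _ hΩm.compl, Measure.restrict_restrict hΩm.compl]
    simp
  · rw [← lintegral_ofReal_mul_of_integral_eq_one hL.le hr0 hr hr1]
    exact lintegral_congr fun x => ofReal_mul_rpow_neg_self (hf0 x) (hpos x) (hzero x)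
  · intro μ hμ hμΩ ρ hρ0 hρ μsing _ h hJ
    have hsum := hdecomp μ hμ hμΩ ρ μsing h
    have hae := (hmin ρ hρ0 hρ (le_self_add.trans hsum.le)).2 hJ
    have hlin : ∫⁻ x in Ω, ENNReal.ofReal (ρ x) = 1 := by
      rw [← hmass]
      exact lintegral_congr_ae (hae.mono fun x hx => congrArg ENNReal.ofReal hx)
    have hsing : μsing Ω = 0 := by
      rw [hlin] at hsum
      exact (ENNReal.add_right_inj ENNReal.one_ne_top).1 (hsum.trans (add_zero 1).symm)
    calc μ = μ.restrict Ω := (Measure.restrict_eq_self_of_ae_mem hμΩ).symm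
      _ = (volume.restrict Ω).withDensity (fun x => ENNReal.ofReal (ρ x)) := by
        rw [h, Measure.restrict_add, Measure.restrict_eq_zero.2 hsing, add_zero,
          restrict_withDensity hΩm]
      _ = (volume.restrict Ω).withDensity (fun x => ENNReal.ofReal (r x)) :=
        withDensity_congr_ae (hae.mono fun x hx => congrArg ENNReal.ofReal hx)
end

section
/- Let Ω = [0,1] and ν = 𝓛¹ restricted to [0,1]. For every n ≥ 1, the unique minimizer of F over {Σ ⊆ [0,1] : 1 ≤ #Σ ≤ n} is the set Σ_n = {(2i−1)/(2n) : i = 1, …, n}, and the minimal value is F(Σ_n) = 1/(4n); consequently θ₁ = 1/4. -/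
open MeasureTheory Filter Topology ENNReal

/-- The average-distance functional `F(Σ) = ∫_0^1 dist(x, Σ) dx` for a finite `Σ ⊆ [0,1]`. -/
noncomputable def F1 (s : Finset ℝ) : ℝ :=
  ∫ x in Set.Icc (0 : ℝ) 1, Metric.infDist x (s : Set ℝ)

/-- The constant `θ₁ = inf { liminf_n n ∫_{[0,1]} dist(x, Σ_n) dx : Σ_n ⊆ [0,1], #Σ_n ≤ n }`. -/
noncomputable def theta1 : ℝ≥0∞ :=
  ⨅ (S : ℕ → Finset ℝ)
    (_ : ∀ n : ℕ, 1 ≤ n → (S n : Set ℝ) ⊆ Set.Icc (0 : ℝ) 1 ∧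
      (S n).Nonempty ∧ (S n).card ≤ n),
    Filter.liminf (fun n : ℕ => (n : ℝ≥0∞) *
      ∫⁻ x in Set.Icc (0 : ℝ) 1, EMetric.infEdist x (S n : Set ℝ)) Filter.atTop

lemma integral_abs_sub_eq_sq (a : ℝ) {r : ℝ} (hr : 0 ≤ r) :
    ∫ x in (a - r)..(a + r), |x - a| = r ^ 2 := by
  rw [intervalIntegral.integral_comp_sub_right (fun x => |x|) a]
  have hI : ∀ u v : ℝ, IntervalIntegrable (fun x : ℝ => |x|) volume u v :=
    fun u v => continuous_abs.intervalIntegrable u v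
  rw [← intervalIntegral.integral_add_adjacent_intervals (hI _ 0) (hI 0 _)]
  have h₁ : ∫ x in (a - r - a)..0, |x| = ∫ x in (a - r - a)..0, -x := by
    refine intervalIntegral.integral_congr fun x hx => ?_
    rw [Set.uIcc_of_le (by linarith)] at hx
    exact abs_of_nonpos hx.2
  have h₂ : ∫ x in (0 : ℝ)..(a + r - a), |x| = ∫ x in (0 : ℝ)..(a + r - a), x := by
    refine intervalIntegral.integral_congr fun x hx => ?_
    rw [Set.uIcc_of_le (by linarith)] at hx
    exact abs_of_nonneg hx.1
  rw [h₁, h₂, intervalIntegral.integral_neg, integral_id, integral_id]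
  ring

lemma setIntegral_tent_le (a : ℝ) {r : ℝ} (hr : 0 ≤ r) :
    ∫ x in Set.Icc (0 : ℝ) 1, max (r - |x - a|) 0 ≤ r ^ 2 := by
  have hc : Continuous fun x : ℝ => max (r - |x - a|) 0 := by fun_prop
  have hzero : ∀ x ∉ Set.Icc (a - r) (a + r), max (r - |x - a|) 0 = 0 := by
    intro x hx
    refine max_eq_right ?_
    by_contra! h
    have := abs_le.1 (by linarith : |x - a| ≤ r)
    exact hx ⟨by linarith [this.1], by linarith [this.2]⟩
  have hint : Integrable fun x : ℝ => max (r - |x - a|) 0 :=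
    hc.integrable_of_hasCompactSupport (HasCompactSupport.intro isCompact_Icc hzero)
  calc ∫ x in Set.Icc (0 : ℝ) 1, max (r - |x - a|) 0
      ≤ ∫ x, max (r - |x - a|) 0 :=
        setIntegral_le_integral hint (Eventually.of_forall fun x => le_max_right _ _)
    _ = ∫ x in Set.Icc (a - r) (a + r), max (r - |x - a|) 0 :=
        (setIntegral_eq_integral_of_forall_compl_eq_zero hzero).symm
    _ = ∫ x in Set.Icc (a - r) (a + r), (r - |x - a|) := by
        refine setIntegral_congr_fun measurableSet_Icc fun x hx => max_eq_left ?_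
        have : |x - a| ≤ r := abs_le.2 ⟨by linarith [hx.1], by linarith [hx.2]⟩
        linarith
    _ = ∫ x in (a - r)..(a + r), (r - |x - a|) := by
        rw [integral_Icc_eq_integral_Ioc, intervalIntegral.integral_of_le (by linarith)]
    _ = r ^ 2 := by
        have hi : IntervalIntegrable (fun x : ℝ => |x - a|) volume (a - r) (a + r) :=
          (by fun_prop : Continuous fun x : ℝ => |x - a|).intervalIntegrable _ _
        rw [intervalIntegral.integral_sub intervalIntegrable_const hi,
          integral_abs_sub_eq_sq a hr, intervalIntegral.integral_const, smul_eq_mul]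
        ring

lemma Finset.exists_infDist_eq {s : Finset ℝ} (hs : s.Nonempty) (x : ℝ) :
    ∃ a ∈ s, Metric.infDist x (s : Set ℝ) = |x - a| :=
  s.finite_toSet.isCompact.exists_infDist_eq_dist (by simpa using hs) x

lemma le_F1 {s : Finset ℝ} (hs : s.Nonempty) {r : ℝ} (hr : 0 ≤ r) :
    r - s.card * r ^ 2 + ∫ x in Set.Icc (0 : ℝ) 1, max (Metric.infDist x (s : Set ℝ) - r) 0
      ≤ F1 s := by
  have hd : Continuous fun x : ℝ => Metric.infDist x (s : Set ℝ) := Metric.continuous_infDist_pt _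
  have hi : ∀ {f : ℝ → ℝ}, Continuous f → IntegrableOn f (Set.Icc 0 1) :=
    fun hf => hf.continuousOn.integrableOn_Icc
  have hsum : ∫ x in Set.Icc (0 : ℝ) 1, max (r - Metric.infDist x (s : Set ℝ)) 0
      ≤ s.card * r ^ 2 := by
    calc ∫ x in Set.Icc (0 : ℝ) 1, max (r - Metric.infDist x (s : Set ℝ)) 0
        ≤ ∫ x in Set.Icc (0 : ℝ) 1, ∑ a ∈ s, max (r - |x - a|) 0 := by
          refine integral_mono (hi (by fun_prop)) (hi (by fun_prop)) fun x => ?_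
          obtain ⟨a, ha, hxa⟩ := s.exists_infDist_eq hs x
          simp only [hxa]
          exact Finset.single_le_sum (f := fun a => max (r - |x - a|) 0)
            (fun _ _ => le_max_right _ _) ha
      _ = ∑ a ∈ s, ∫ x in Set.Icc (0 : ℝ) 1, max (r - |x - a|) 0 :=
          integral_finsetSum _ fun a _ => hi (by fun_prop)
      _ ≤ ∑ a ∈ s, r ^ 2 := Finset.sum_le_sum fun a _ => setIntegral_tent_le a hr
      _ = s.card * r ^ 2 := by simp
  have hsplit : F1 s = r - (∫ x in Set.Icc (0 : ℝ) 1, max (r - Metric.infDist x (s : Set ℝ)) 0)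
      + ∫ x in Set.Icc (0 : ℝ) 1, max (Metric.infDist x (s : Set ℝ) - r) 0 := by
    have hconst : ∫ _ in Set.Icc (0 : ℝ) 1, r = r := by simp
    refine Eq.trans ?_ (congrArg (fun c => c - _ + _) hconst)
    have hg : Continuous fun x : ℝ => max (r - Metric.infDist x (s : Set ℝ)) 0 := by fun_prop
    have hh : Continuous fun x : ℝ => max (Metric.infDist x (s : Set ℝ) - r) 0 := by fun_prop
    rw [F1, ← integral_sub (hi continuous_const) (hi hg),
      ← integral_add (hi (by fun_prop : Continuous fun x : ℝ =>
        r - max (r - Metric.infDist x (s : Set ℝ)) 0)) (hi hh)]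
    congr 1 with x
    rcases le_total (Metric.infDist x (s : Set ℝ)) r with h | h
    · rw [max_eq_left (by linarith), max_eq_right (by linarith)]; ring
    · rw [max_eq_right (by linarith), max_eq_left (by linarith)]; ring
  linarith

lemma one_div_four_mul_le_F1 {n : ℕ} (hn : 1 ≤ n) {s : Finset ℝ} (hs : s.Nonempty)
    (hcard : s.card ≤ n) : 1 / (4 * n : ℝ) ≤ F1 s := by
  have hn' : (0 : ℝ) < n := by exact_mod_cast hn
  have hr : (0 : ℝ) ≤ 1 / (2 * n) := by positivity
  have h := le_F1 hs hr
  have hpos : 0 ≤ ∫ x in Set.Icc (0 : ℝ) 1, max (Metric.infDist x (s : Set ℝ) - 1 / (2 * n)) 0 :=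
    integral_nonneg fun x => le_max_right _ _
  have hc : (s.card : ℝ) * (1 / (2 * n)) ^ 2 ≤ n * (1 / (2 * n)) ^ 2 := by gcongr
  have he : (1 / (2 * n) : ℝ) - n * (1 / (2 * n)) ^ 2 = 1 / (4 * n) := by field_simp; norm_num
  linarith

/-- A minimal value forces `n` points, and every point of `[0,1]` lies within `1 / (2n)` of them. -/
lemma card_eq_and_infDist_le_of_F1_eq {n : ℕ} (hn : 1 ≤ n) {s : Finset ℝ} (hs : s.Nonempty)
    (hcard : s.card ≤ n) (hF : F1 s = 1 / (4 * n)) :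
    s.card = n ∧ ∀ x ∈ Set.Icc (0 : ℝ) 1, Metric.infDist x (s : Set ℝ) ≤ 1 / (2 * n) := by
  have hn' : (0 : ℝ) < n := by exact_mod_cast hn
  have hr : (0 : ℝ) < 1 / (2 * n) := by positivity
  have h := le_F1 hs hr.le
  have hpos : 0 ≤ ∫ x in Set.Icc (0 : ℝ) 1, max (Metric.infDist x (s : Set ℝ) - 1 / (2 * n)) 0 :=
    integral_nonneg fun x => le_max_right _ _
  have hc : (s.card : ℝ) * (1 / (2 * n)) ^ 2 ≤ n * (1 / (2 * n)) ^ 2 := by gcongr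
  have he : (1 / (2 * n) : ℝ) - n * (1 / (2 * n)) ^ 2 = 1 / (4 * n) := by field_simp; norm_num
  refine ⟨?_, ?_⟩
  · by_contra hne
    have hlt : (s.card : ℝ) < n := by exact_mod_cast lt_of_le_of_ne hcard hne
    have : (s.card : ℝ) * (1 / (2 * n)) ^ 2 < n * (1 / (2 * n)) ^ 2 := by gcongr
    linarith
  · have hcont : Continuous fun x : ℝ => max (Metric.infDist x (s : Set ℝ) - 1 / (2 * n)) 0 := by
      have := Metric.continuous_infDist_pt (s : Set ℝ)
      fun_prop
    have hzero : ∫ x in Set.Icc (0 : ℝ) 1,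
        max (Metric.infDist x (s : Set ℝ) - 1 / (2 * n)) 0 = 0 := by linarith
    have hae := (integral_eq_zero_iff_of_nonneg (fun x => le_max_right _ _)
      hcont.continuousOn.integrableOn_Icc).1 hzero
    have heq := Measure.eqOn_Icc_of_ae_eq volume zero_ne_one hae hcont.continuousOn
      continuousOn_const
    intro x hx
    have := heq hx
    have h2 := le_max_left (Metric.infDist x (s : Set ℝ) - 1 / (2 * n)) 0
    simp only [Pi.zero_apply] at this
    linarith

lemma le_of_cover_Icc {n : ℕ} {r : ℝ} {a : Fin n → ℝ} (hr : 0 ≤ r) (ha : Monotone a)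
    (ha1 : ∀ i, a i ≤ 1) (hcov : ∀ x ∈ Set.Icc (0 : ℝ) 1, ∃ i, |x - a i| ≤ r) (i : Fin n) :
    a i ≤ (2 * (i : ℝ) + 1) * r := by
  induction i using WellFoundedLT.induction with
  | ind i ih =>
    by_contra! hlt
    have hi0 : (0 : ℝ) ≤ (i : ℕ) := Nat.cast_nonneg _
    have h0 : 0 ≤ (i : ℝ) * r := by positivity
    have h1 := ha1 i
    obtain ⟨j, hj⟩ := hcov (2 * i * r + (a i - (2 * i + 1) * r) / 2)
      ⟨by linarith, by linarith⟩
    have hj' := abs_le.1 hj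
    rcases lt_or_ge j i with hji | hji
    · have h2 := ih j hji
      have h3 : (j : ℝ) + 1 ≤ (i : ℝ) := by exact_mod_cast hji
      have h4 := mul_le_mul_of_nonneg_right h3 hr
      linarith [hj'.2]
    · linarith [hj'.1, ha hji]

lemma eq_midpoints_of_infDist_le {n : ℕ} (hn : 1 ≤ n) {s : Finset ℝ}
    (hsub : (s : Set ℝ) ⊆ Set.Icc (0 : ℝ) 1) (hs : s.Nonempty) (hcard : s.card = n)
    (hd : ∀ x ∈ Set.Icc (0 : ℝ) 1, Metric.infDist x (s : Set ℝ) ≤ 1 / (2 * n)) :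
    s = (Finset.range n).image (fun i : ℕ => (2 * (i : ℝ) + 1) / (2 * n)) := by
  have hn' : (0 : ℝ) < n := by exact_mod_cast hn
  have hr : (0 : ℝ) ≤ 1 / (2 * n) := by positivity
  set a := s.orderEmbOfFin hcard with ha
  have hmem : ∀ i, a i ∈ Set.Icc (0 : ℝ) 1 := fun i => hsub (s.orderEmbOfFin_mem hcard i)
  have hcov : ∀ x ∈ Set.Icc (0 : ℝ) 1, ∃ i, |x - a i| ≤ 1 / (2 * n) := by
    intro x hx
    obtain ⟨b, hb, hxb⟩ := s.exists_infDist_eq hs x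
    have : b ∈ Set.range a := by rw [ha, s.range_orderEmbOfFin hcard]; exact hb
    obtain ⟨i, rfl⟩ := this
    exact ⟨i, hxb ▸ hd x hx⟩
  have hle := le_of_cover_Icc hr a.monotone (fun i => (hmem i).2) hcov
  have hge := le_of_cover_Icc (a := fun i => 1 - a i.rev) hr
    (fun i j hij => by
      have := a.monotone (Fin.rev_le_rev.2 hij)
      simp only
      linarith)
    (fun i => by linarith [(hmem i.rev).1])
    (fun x hx => by
      obtain ⟨i, hi⟩ := hcov (1 - x) ⟨by linarith [hx.2], by linarith [hx.1]⟩
      refine ⟨i.rev, ?_⟩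
      rw [Fin.rev_rev, abs_sub_comm]
      convert hi using 2
      ring)
  have heq : ∀ i : Fin n, a i = (2 * (i : ℝ) + 1) / (2 * n) := by
    intro i
    refine le_antisymm ((hle i).trans_eq (by ring)) ?_
    have h := hge i.rev
    rw [Fin.rev_rev, Fin.val_rev, Nat.cast_sub (by omega)] at h
    push_cast at h
    have : (2 * ((n : ℝ) - (i + 1)) + 1) * (1 / (2 * n)) = 1 - (2 * (i : ℝ) + 1) / (2 * n) := by
      field_simp
      ring
    linarith
  have hrange : (s : Set ℝ) = Set.range a := (s.range_orderEmbOfFin hcard).symm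
  ext y
  rw [← Finset.mem_coe, hrange, Finset.mem_image]
  constructor
  · rintro ⟨i, rfl⟩
    exact ⟨i, Finset.mem_range.2 i.2, (heq i).symm⟩
  · rintro ⟨i, hi, rfl⟩
    exact ⟨⟨i, Finset.mem_range.1 hi⟩, heq _⟩

lemma midpoints_subset_Icc {n : ℕ} (hn : 1 ≤ n) :
    ((Finset.range n).image (fun i : ℕ => (2 * (i : ℝ) + 1) / (2 * n)) : Set ℝ)
      ⊆ Set.Icc (0 : ℝ) 1 := by
  have hn' : (0 : ℝ) < n := by exact_mod_cast hn
  intro y hy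
  simp only [Finset.coe_image, Set.mem_image, Finset.mem_coe, Finset.mem_range] at hy
  obtain ⟨i, hi, rfl⟩ := hy
  have : (i : ℝ) + 1 ≤ n := by exact_mod_cast hi
  refine ⟨by positivity, ?_⟩
  rw [div_le_one (by positivity)]
  linarith

lemma midpoints_nonempty {n : ℕ} (hn : 1 ≤ n) :
    ((Finset.range n).image (fun i : ℕ => (2 * (i : ℝ) + 1) / (2 * n))).Nonempty :=
  (Finset.nonempty_range_iff.2 (by omega)).image _

lemma midpoints_card_le (n : ℕ) :
    ((Finset.range n).image (fun i : ℕ => (2 * (i : ℝ) + 1) / (2 * n))).card ≤ n :=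
  Finset.card_image_le.trans_eq (Finset.card_range n)

lemma F1_midpoints {n : ℕ} (hn : 1 ≤ n) :
    F1 ((Finset.range n).image (fun i : ℕ => (2 * (i : ℝ) + 1) / (2 * n))) = 1 / (4 * n) := by
  refine le_antisymm ?_ (one_div_four_mul_le_F1 hn (midpoints_nonempty hn) (midpoints_card_le n))
  have hn' : (0 : ℝ) < n := by exact_mod_cast hn
  set T := (Finset.range n).image (fun i : ℕ => (2 * (i : ℝ) + 1) / (2 * n)) with hT
  have hd : Continuous fun x : ℝ => Metric.infDist x (T : Set ℝ) := Metric.continuous_infDist_pt _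
  have hsum := intervalIntegral.sum_integral_adjacent_intervals (μ := volume)
    (a := fun k : ℕ => (k : ℝ) / n) (n := n) fun k _ => hd.intervalIntegrable _ _
  simp only [Nat.cast_zero, zero_div, div_self hn'.ne'] at hsum
  rw [F1, integral_Icc_eq_integral_Ioc, ← intervalIntegral.integral_of_le zero_le_one, ← hsum]
  have hbound : ∀ k ∈ Finset.range n,
      ∫ x in ((k : ℝ) / n)..(((k + 1 : ℕ) : ℝ) / n), Metric.infDist x (T : Set ℝ)
        ≤ (1 / (2 * n)) ^ 2 := by
    intro k hk
    rw [← integral_abs_sub_eq_sq ((2 * (k : ℝ) + 1) / (2 * n)) (r := 1 / (2 * n)) (by positivity)]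
    have e₁ : (2 * (k : ℝ) + 1) / (2 * n) - 1 / (2 * n) = k / n := by field_simp; ring
    have e₂ : (2 * (k : ℝ) + 1) / (2 * n) + 1 / (2 * n) = ((k + 1 : ℕ) : ℝ) / n := by
      push_cast; field_simp; ring
    rw [e₁, e₂]
    refine intervalIntegral.integral_mono_on (by gcongr; omega) (hd.intervalIntegrable _ _)
      ((by fun_prop : Continuous fun x : ℝ =>
        |x - (2 * (k : ℝ) + 1) / (2 * n)|).intervalIntegrable _ _) fun x _ => ?_
    rw [← Real.dist_eq]
    exact Metric.infDist_le_dist_of_mem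
      (Finset.mem_coe.2 (Finset.mem_image_of_mem (fun i : ℕ => (2 * (i : ℝ) + 1) / (2 * n)) hk))
  refine (Finset.sum_le_sum hbound).trans_eq ?_
  rw [Finset.sum_const, Finset.card_range, nsmul_eq_mul]
  field_simp
  norm_num

lemma lintegral_infEDist_eq_ofReal_F1 {s : Finset ℝ} (hs : s.Nonempty) :
    ∫⁻ x in Set.Icc (0 : ℝ) 1, Metric.infEDist x (s : Set ℝ) = ENNReal.ofReal (F1 s) := by
  rw [F1, ofReal_integral_eq_lintegral_ofReal
    (Metric.continuous_infDist_pt _).continuousOn.integrableOn_Icc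
    (Eventually.of_forall fun x => Metric.infDist_nonneg)]
  refine lintegral_congr fun x => ?_
  rw [Metric.infDist, ENNReal.ofReal_toReal (Metric.infEDist_ne_top (by simpa using hs))]

lemma natCast_mul_ofReal_one_div {n : ℕ} (hn : 1 ≤ n) :
    (n : ℝ≥0∞) * ENNReal.ofReal (1 / (4 * n)) = 1 / 4 := by
  have hn' : (0 : ℝ) < n := by exact_mod_cast hn
  rw [← ENNReal.ofReal_natCast n, ← ENNReal.ofReal_mul hn'.le,
    show (n : ℝ) * (1 / (4 * n)) = 1 / 4 by field_simp, ENNReal.ofReal_div_of_pos (by norm_num)]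
  simp

lemma theta1_eq : theta1 = 1 / 4 := by
  refine le_antisymm ?_ ?_
  · refine iInf₂_le_of_le
      (fun n => (Finset.range n).image (fun i : ℕ => (2 * (i : ℝ) + 1) / (2 * n)))
      (fun n hn => ⟨midpoints_subset_Icc hn, midpoints_nonempty hn, midpoints_card_le n⟩) ?_
    refine (Tendsto.liminf_eq (tendsto_const_nhds.congr' ?_)).le
    filter_upwards [eventually_ge_atTop 1] with n hn
    refine Eq.symm ((congrArg ((n : ℝ≥0∞) * ·)
      (lintegral_infEDist_eq_ofReal_F1 (midpoints_nonempty hn))).trans ?_)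
    simp only [F1_midpoints hn, natCast_mul_ofReal_one_div hn]
  · refine le_iInf₂ fun S hS => le_liminf_of_le (by isBoundedDefault) ?_
    filter_upwards [eventually_ge_atTop 1] with n hn
    obtain ⟨-, hne, hcard⟩ := hS n hn
    refine le_of_le_of_eq ?_
      (congrArg ((n : ℝ≥0∞) * ·) (lintegral_infEDist_eq_ofReal_F1 hne)).symm
    rw [← natCast_mul_ofReal_one_div hn]
    gcongr
    exact one_div_four_mul_le_F1 hn hne hcard

theorem stmt7 :
    (∀ n : ℕ, 1 ≤ n →
      ∀ T : Finset ℝ, T = (Finset.range n).image (fun i : ℕ => (2 * (i : ℝ) + 1) / (2 * n)) →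
        (T : Set ℝ) ⊆ Set.Icc (0 : ℝ) 1 ∧ T.Nonempty ∧ T.card ≤ n ∧
        F1 T = 1 / (4 * n) ∧
        (∀ s : Finset ℝ, (s : Set ℝ) ⊆ Set.Icc (0 : ℝ) 1 → s.Nonempty → s.card ≤ n →
          F1 T ≤ F1 s ∧ (F1 s = F1 T → s = T))) ∧
    theta1 = 1 / 4 := by
  refine ⟨?_, theta1_eq⟩
  rintro n hn T rfl
  refine ⟨midpoints_subset_Icc hn, midpoints_nonempty hn, midpoints_card_le n,
    F1_midpoints hn, fun s hsub hs hcard => ?_⟩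
  rw [F1_midpoints hn]
  refine ⟨one_div_four_mul_le_F1 hn hs hcard, fun hF => ?_⟩
  obtain ⟨hc, hd⟩ := card_eq_and_infDist_le_of_F1_eq hn hs hcard hF
  exact eq_midpoints_of_infDist_le hn hsub hs hc hd
end

section
/- Let Ω = [0,1], ν = 𝓛¹ restricted to [0,1], and let Σ = {x₁ ≤ … ≤ x_k} ⊆ [0,1] be a nonempty finite set. If x ∈ [x_{i−1}, x_i] lies in an internal interval Δ_i of the partition induced by Σ (with length λ_i = x_i − x_{i−1}), then F(Σ ∪ {x}) = F(Σ) − (x_i − x)(x − x_{i−1})/2; consequently the minimum of F(Σ ∪ {x}) over x ∈ Δ_i equals F(Σ) − λ_i²/8 and is attained exactly at the midpoint x = (x_{i−1} + x_i)/2. -/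
open MeasureTheory Filter Topology
open scoped Classical

lemma integral_min_sub_sub (a b : ℝ) (hab : a ≤ b) :
    ∫ y in a..b, min (y - a) (b - y) = (b - a) ^ 2 / 4 := by
  have hi : ∀ c d : ℝ, IntervalIntegrable (fun y : ℝ => min (y - a) (b - y)) volume c d :=
    fun c d => Continuous.intervalIntegrable (by fun_prop) c d
  rw [← intervalIntegral.integral_add_adjacent_intervals (hi a ((a + b) / 2)) (hi _ b)]
  have h1 : ∫ y in a..(a + b) / 2, min (y - a) (b - y) = ∫ y in a..(a + b) / 2, (y - a) := by
    refine intervalIntegral.integral_congr fun y hy => ?_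
    rw [Set.uIcc_of_le (by linarith)] at hy
    exact min_eq_left (by linarith [hy.2])
  have h2 : ∫ y in (a + b) / 2..b, min (y - a) (b - y) = ∫ y in (a + b) / 2..b, (b - y) := by
    refine intervalIntegral.integral_congr fun y hy => ?_
    rw [Set.uIcc_of_le (by linarith)] at hy
    exact min_eq_right (by linarith [hy.1])
  rw [h1, h2, intervalIntegral.integral_sub (by simp) (by simp),
    intervalIntegral.integral_sub (by simp) (by simp)]
  simp only [integral_id, intervalIntegral.integral_const, smul_eq_mul]
  ring

lemma infDist_eq_min_of_gap {t : Set ℝ} {a b y : ℝ} (ha : a ∈ t) (hb : b ∈ t)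
    (hgap : ∀ z ∈ t, z ∉ Set.Ioo a b) (hy : y ∈ Set.Icc a b) :
    Metric.infDist y t = min (y - a) (b - y) := by
  apply le_antisymm
  · refine le_min ?_ ?_
    · simpa [Real.dist_eq, abs_of_nonneg (sub_nonneg.2 hy.1)] using
        Metric.infDist_le_dist_of_mem (x := y) ha
    · simpa [Real.dist_eq, abs_sub_comm y b, abs_of_nonneg (sub_nonneg.2 hy.2)] using
        Metric.infDist_le_dist_of_mem (x := y) hb
  · refine (Metric.le_infDist ⟨a, ha⟩).2 fun {z} hz => ?_
    rw [Real.dist_eq]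
    rcases le_or_gt z a with h | h
    · exact (min_le_left _ _).trans ((by linarith : y - a ≤ y - z).trans (le_abs_self _))
    · have hbz : b ≤ z := not_lt.1 fun h' => hgap z hz ⟨h, h'⟩
      exact (min_le_right _ _).trans ((by linarith : b - y ≤ -(y - z)).trans (neg_le_abs _))

lemma integral_infDist_of_gap {t : Set ℝ} {a b : ℝ} (ha : a ∈ t) (hb : b ∈ t) (hab : a ≤ b)
    (hgap : ∀ z ∈ t, z ∉ Set.Ioo a b) :
    ∫ y in a..b, Metric.infDist y t = (b - a) ^ 2 / 4 := by
  rw [← integral_min_sub_sub a b hab]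
  refine intervalIntegral.integral_congr fun y hy => ?_
  rw [Set.uIcc_of_le hab] at hy
  exact infDist_eq_min_of_gap ha hb hgap hy

lemma infDist_insert_of_dist_le {α : Type*} [PseudoMetricSpace α] {t : Set α} {c x y : α}
    (hc : c ∈ t) (h : dist y c ≤ dist y x) :
    Metric.infDist y (insert x t) = Metric.infDist y t := by
  apply le_antisymm
  · exact Metric.infDist_le_infDist_of_subset (Set.subset_insert _ _) ⟨c, hc⟩
  · refine (Metric.le_infDist (Set.insert_nonempty _ _)).2 fun {z} hz => ?_
    rcases hz with rfl | hz
    · exact (Metric.infDist_le_dist_of_mem hc).trans h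
    · exact Metric.infDist_le_dist_of_mem hz

lemma F1_eq_add (s : Finset ℝ) (a b : ℝ) :
    F1 s = (∫ y in (0 : ℝ)..a, Metric.infDist y (s : Set ℝ)) +
      (∫ y in a..b, Metric.infDist y (s : Set ℝ)) +
      ∫ y in b..1, Metric.infDist y (s : Set ℝ) := by
  have hi : ∀ c d : ℝ, IntervalIntegrable (fun y => Metric.infDist y (s : Set ℝ)) volume c d :=
    fun c d => (Metric.continuous_infDist_pt _).intervalIntegrable c d
  rw [F1, integral_Icc_eq_integral_Ioc, ← intervalIntegral.integral_of_le zero_le_one,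
    intervalIntegral.integral_add_adjacent_intervals (hi _ _) (hi _ _),
    intervalIntegral.integral_add_adjacent_intervals (hi _ _) (hi _ _)]

lemma F1_insert_of_gap {s : Finset ℝ} (hs : (s : Set ℝ) ⊆ Set.Icc (0 : ℝ) 1)
    {a b x : ℝ} (ha : a ∈ s) (hb : b ∈ s) (hgap : ∀ y ∈ s, y ∉ Set.Ioo a b)
    (hx : x ∈ Set.Icc a b) :
    F1 (insert x s) = F1 s - (b - x) * (x - a) / 2 := by
  have ha' : a ∈ (s : Set ℝ) := ha
  have hb' : b ∈ (s : Set ℝ) := hb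
  obtain ⟨hax, hxb⟩ := hx
  rw [F1_eq_add s a b, F1_eq_add (insert x s) a b, Finset.coe_insert]
  have hi : ∀ c d : ℝ, IntervalIntegrable
      (fun y => Metric.infDist y (insert x (s : Set ℝ))) volume c d :=
    fun c d => (Metric.continuous_infDist_pt _).intervalIntegrable c d
  have hleft : ∫ y in (0 : ℝ)..a, Metric.infDist y (insert x (s : Set ℝ)) =
      ∫ y in (0 : ℝ)..a, Metric.infDist y (s : Set ℝ) := by
    refine intervalIntegral.integral_congr fun y hy => ?_
    rw [Set.uIcc_of_le (hs ha').1] at hy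
    refine infDist_insert_of_dist_le ha' ?_
    rw [Real.dist_eq, Real.dist_eq, abs_of_nonpos (by linarith [hy.2]),
      abs_of_nonpos (by linarith [hy.2])]
    linarith
  have hright : ∫ y in b..1, Metric.infDist y (insert x (s : Set ℝ)) =
      ∫ y in b..1, Metric.infDist y (s : Set ℝ) := by
    refine intervalIntegral.integral_congr fun y hy => ?_
    rw [Set.uIcc_of_le (hs hb').2] at hy
    refine infDist_insert_of_dist_le hb' ?_
    rw [Real.dist_eq, Real.dist_eq, abs_of_nonneg (by linarith [hy.1]),
      abs_of_nonneg (by linarith [hy.1])]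
    linarith
  have hgap₁ : ∀ z ∈ insert x (s : Set ℝ), z ∉ Set.Ioo a x := by
    rintro z (rfl | hz) ⟨h₁, h₂⟩
    · exact lt_irrefl _ h₂
    · exact hgap z hz ⟨h₁, h₂.trans_le hxb⟩
  have hgap₂ : ∀ z ∈ insert x (s : Set ℝ), z ∉ Set.Ioo x b := by
    rintro z (rfl | hz) ⟨h₁, h₂⟩
    · exact lt_irrefl _ h₁
    · exact hgap z hz ⟨hax.trans_lt h₁, h₂⟩
  rw [hleft, hright, ← intervalIntegral.integral_add_adjacent_intervals (hi a x) (hi x b),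
    integral_infDist_of_gap (Set.mem_insert_of_mem _ ha') (Set.mem_insert _ _) hax hgap₁,
    integral_infDist_of_gap (Set.mem_insert _ _) (Set.mem_insert_of_mem _ hb') hxb hgap₂,
    integral_infDist_of_gap ha' hb' (hax.trans hxb) hgap]
  ring

theorem stmt11 (s : Finset ℝ) (hs : (s : Set ℝ) ⊆ Set.Icc (0 : ℝ) 1) (hsne : s.Nonempty)
    (a b : ℝ) (ha : a ∈ s) (hb : b ∈ s) (hab : a ≤ b)
    (hgap : ∀ y ∈ s, y ∉ Set.Ioo a b) :
    (∀ x ∈ Set.Icc a b, F1 (insert x s) = F1 s - (b - x) * (x - a) / 2) ∧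
    F1 (insert ((a + b) / 2) s) = F1 s - (b - a) ^ 2 / 8 ∧
    (∀ x ∈ Set.Icc a b,
      F1 s - (b - a) ^ 2 / 8 ≤ F1 (insert x s) ∧
      (F1 (insert x s) = F1 s - (b - a) ^ 2 / 8 → x = (a + b) / 2)) := by
  have key : ∀ x ∈ Set.Icc a b, F1 (insert x s) = F1 s - (b - x) * (x - a) / 2 :=
    fun x hx => F1_insert_of_gap hs ha hb hgap hx
  refine ⟨key, ?_, fun x hx => ?_⟩
  · rw [key _ ⟨by linarith, by linarith⟩]
    ring
  · rw [key x hx]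
    refine ⟨by nlinarith [sq_nonneg (x - (a + b) / 2)], fun h => ?_⟩
    have hsq : (x - (a + b) / 2) ^ 2 = 0 := by linarith
    exact sub_eq_zero.1 (pow_eq_zero_iff two_ne_zero |>.1 hsq)
end

section
/- Let Ω = [0,1], ν = 𝓛¹ restricted to [0,1], and let Σ = {x₁ ≤ … ≤ x_k} ⊆ [0,1] be a nonempty finite set with x₁ > 0. If x ∈ [0, x₁] lies in the external interval Δ₁ = [0, x₁] (of length λ₁ = x₁), then F(Σ ∪ {x}) = F(Σ) − (x₁² + 2x₁x − 3x²)/4; consequently the minimum of F(Σ ∪ {x}) over x ∈ Δ₁ equals F(Σ) − λ₁²/3 and is attained exactly at x = x₁/3, the point dividing Δ₁ in ratio 1:2 with the shorter part toward the boundary of [0,1]. The symmetric statement holds for the external interval Δ_{k+1} = [x_k, 1]. -/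
open MeasureTheory Filter Topology
open scoped Classical

theorem infDist_insert_eq_min {X : Type*} [PseudoMetricSpace X] {s : Set X} (hs : s.Nonempty)
    (x t : X) : Metric.infDist t (insert x s) = min (dist t x) (Metric.infDist t s) := by
  apply le_antisymm
  · exact le_min (Metric.infDist_le_dist_of_mem (Set.mem_insert x s))
      (Metric.infDist_le_infDist_of_subset (Set.subset_insert x s) hs)
  · rw [Metric.le_infDist (Set.insert_nonempty x s)]
    rintro y (rfl | hy)
    · exact min_le_left _ _
    · exact (min_le_right _ _).trans (Metric.infDist_le_dist_of_mem hy)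

theorem infDist_eq_sub_of_le {s : Set ℝ} {a t : ℝ} (ha : IsLeast s a) (ht : t ≤ a) :
    Metric.infDist t s = a - t := by
  apply le_antisymm
  · refine (Metric.infDist_le_dist_of_mem ha.1).trans_eq ?_
    rw [Real.dist_eq, abs_of_nonpos (by linarith)]
    ring
  · rw [Metric.le_infDist ⟨a, ha.1⟩]
    intro y hy
    have := ha.2 hy
    rw [Real.dist_eq, abs_of_nonpos (by linarith)]
    linarith

theorem F1_eq_intervalIntegral (s : Finset ℝ) :
    F1 s = ∫ t in (0 : ℝ)..1, Metric.infDist t (s : Set ℝ) := by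
  rw [F1, integral_Icc_eq_integral_Ioc, intervalIntegral.integral_of_le zero_le_one]

theorem F1_insert_of_le_least {s : Finset ℝ} {a x : ℝ} (ha : IsLeast (s : Set ℝ) a)
    (ha1 : a ≤ 1) (hx : x ∈ Set.Icc 0 a) :
    F1 (insert x s) = F1 s - (a ^ 2 + 2 * a * x - 3 * x ^ 2) / 4 := by
  obtain ⟨hx0, hxa⟩ := hx
  have hne : (s : Set ℝ).Nonempty := ⟨a, ha.1⟩
  have hcont : ∀ S : Set ℝ, Continuous fun t => Metric.infDist t S :=
    Metric.continuous_infDist_pt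
  have hint : ∀ (S : Set ℝ) (u v : ℝ),
      IntervalIntegrable (fun t => Metric.infDist t S) volume u v :=
    fun S u v => (hcont S).intervalIntegrable u v
  set g : ℝ → ℝ := fun t => Metric.infDist t (s : Set ℝ) - Metric.infDist t (insert x (s : Set ℝ))
  have hg : ∀ u v : ℝ, IntervalIntegrable g volume u v :=
    fun u v => (hint _ u v).sub (hint _ u v)
  have hdiff : F1 s - F1 (insert x s) = ∫ t in (0 : ℝ)..1, g t := by
    rw [F1_eq_intervalIntegral, F1_eq_intervalIntegral, Finset.coe_insert,
      ← intervalIntegral.integral_sub (hint _ _ _) (hint _ _ _)]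
  have hbelow : ∫ t in (0 : ℝ)..x, g t = ∫ _ in (0 : ℝ)..x, (a - x) := by
    refine intervalIntegral.integral_congr fun t ht => ?_
    rw [Set.uIcc_of_le hx0] at ht
    simp only [g]
    rw [infDist_insert_eq_min hne, infDist_eq_sub_of_le ha (ht.2.trans hxa), Real.dist_eq,
      abs_of_nonpos (by linarith [ht.2]), min_eq_left (by linarith)]
    ring
  have hmiddle : ∫ t in x..(a + x) / 2, g t = ∫ t in x..(a + x) / 2, (a + x - 2 * t) := by
    refine intervalIntegral.integral_congr fun t ht => ?_
    rw [Set.uIcc_of_le (by linarith)] at ht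
    simp only [g]
    rw [infDist_insert_eq_min hne, infDist_eq_sub_of_le ha (by linarith [ht.2]), Real.dist_eq,
      abs_of_nonneg (by linarith [ht.1]), min_eq_left (by linarith [ht.2])]
    ring
  have habove : ∫ t in (a + x) / 2..1, g t = ∫ _ in (a + x) / 2..1, (0 : ℝ) := by
    refine intervalIntegral.integral_congr fun t ht => ?_
    rw [Set.uIcc_of_le (by linarith)] at ht
    simp only [g]
    rw [infDist_insert_eq_min hne, min_eq_right, sub_self]
    rw [Real.dist_eq, abs_of_nonneg (by linarith [ht.1])]
    rcases le_total t a with hta | hta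
    · rw [infDist_eq_sub_of_le ha hta]
      linarith [ht.1]
    · refine (Metric.infDist_le_dist_of_mem ha.1).trans ?_
      rw [Real.dist_eq, abs_of_nonneg (by linarith)]
      linarith
  have hlin : ∫ t in x..(a + x) / 2, (a + x - 2 * t) = (a - x) ^ 2 / 4 := by
    rw [intervalIntegral.integral_sub (by simp) (by apply Continuous.intervalIntegrable; fun_prop),
      intervalIntegral.integral_const_mul, intervalIntegral.integral_const, integral_id, smul_eq_mul]
    ring
  rw [← intervalIntegral.integral_add_adjacent_intervals (hg 0 x) (hg x 1),
    ← intervalIntegral.integral_add_adjacent_intervals (hg x ((a + x) / 2)) (hg _ 1),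
    hbelow, hmiddle, habove, hlin, intervalIntegral.integral_const,
    intervalIntegral.integral_zero, smul_eq_mul] at hdiff
  linear_combination -hdiff

theorem F1_image_one_sub (s : Finset ℝ) : F1 (s.image fun t => 1 - t) = F1 s := by
  have hiso : Isometry fun t : ℝ => 1 - t :=
    Isometry.of_dist_eq fun x y => dist_sub_left 1 x y
  rw [F1_eq_intervalIntegral, F1_eq_intervalIntegral]
  have hsymm := intervalIntegral.integral_comp_sub_left (a := 0) (b := 1)
    (fun t => Metric.infDist t ((s.image fun t => 1 - t : Finset ℝ) : Set ℝ)) (1 : ℝ)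
  rw [sub_self, sub_zero] at hsymm
  rw [← hsymm]
  refine intervalIntegral.integral_congr fun t _ => ?_
  rw [Finset.coe_image]
  exact Metric.infDist_image hiso

theorem F1_insert_of_greatest_le {s : Finset ℝ} {b x : ℝ} (hb : IsGreatest (s : Set ℝ) b)
    (hb0 : 0 ≤ b) (hx : x ∈ Set.Icc b 1) :
    F1 (insert x s) =
      F1 s - ((1 - b) ^ 2 + 2 * (1 - b) * (1 - x) - 3 * (1 - x) ^ 2) / 4 := by
  have hleast : IsLeast ((s.image fun t => 1 - t : Finset ℝ) : Set ℝ) (1 - b) := by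
    refine ⟨Finset.mem_coe.2 (Finset.mem_image_of_mem _ (Finset.mem_coe.1 hb.1)), ?_⟩
    intro y hy
    obtain ⟨z, hz, rfl⟩ := Finset.mem_image.1 (Finset.mem_coe.1 hy)
    linarith [hb.2 (Finset.mem_coe.2 hz)]
  have h := F1_insert_of_le_least (x := 1 - x) hleast (by linarith)
    ⟨by linarith [hx.2], by linarith [hx.1]⟩
  rwa [← Finset.image_insert, F1_image_one_sub, F1_image_one_sub] at h


theorem stmt12 (s : Finset ℝ) (hs : (s : Set ℝ) ⊆ Set.Icc (0 : ℝ) 1) (hsne : s.Nonempty) :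
    -- the left external interval `Δ₁ = [0, x₁]`
    (∀ a : ℝ, a ∈ s → (∀ y ∈ s, a ≤ y) → 0 < a →
      (∀ x ∈ Set.Icc (0 : ℝ) a,
        F1 (insert x s) = F1 s - (a ^ 2 + 2 * a * x - 3 * x ^ 2) / 4) ∧
      F1 (insert (a / 3) s) = F1 s - a ^ 2 / 3 ∧
      (∀ x ∈ Set.Icc (0 : ℝ) a,
        F1 s - a ^ 2 / 3 ≤ F1 (insert x s) ∧
        (F1 (insert x s) = F1 s - a ^ 2 / 3 → x = a / 3))) ∧
    -- the symmetric statement for the right external interval `Δ_{k+1} = [x_k, 1]`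
    (∀ b : ℝ, b ∈ s → (∀ y ∈ s, y ≤ b) → b < 1 →
      (∀ x ∈ Set.Icc b (1 : ℝ),
        F1 (insert x s) =
          F1 s - ((1 - b) ^ 2 + 2 * (1 - b) * (1 - x) - 3 * (1 - x) ^ 2) / 4) ∧
      F1 (insert ((2 + b) / 3) s) = F1 s - (1 - b) ^ 2 / 3 ∧
      (∀ x ∈ Set.Icc b (1 : ℝ),
        F1 s - (1 - b) ^ 2 / 3 ≤ F1 (insert x s) ∧
        (F1 (insert x s) = F1 s - (1 - b) ^ 2 / 3 → x = (2 + b) / 3))) := by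
  refine ⟨fun a ha hmin ha0 => ?_, fun b hb hmax hb1 => ?_⟩
  · have hF : ∀ x ∈ Set.Icc (0 : ℝ) a,
        F1 (insert x s) = F1 s - (a ^ 2 + 2 * a * x - 3 * x ^ 2) / 4 :=
      fun x hx => F1_insert_of_le_least ⟨ha, hmin⟩ (hs ha).2 hx
    refine ⟨hF, ?_, fun x hx => ⟨?_, fun h => ?_⟩⟩
    · rw [hF _ ⟨by linarith, by linarith⟩]
      ring
    · rw [hF x hx]
      linarith [sq_nonneg (a - 3 * x)]
    · rw [hF x hx] at h
      have hsq : (a - 3 * x) ^ 2 = 0 := by linarith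
      linarith [pow_eq_zero_iff two_ne_zero |>.1 hsq]
  · have hF : ∀ x ∈ Set.Icc b (1 : ℝ), F1 (insert x s) =
        F1 s - ((1 - b) ^ 2 + 2 * (1 - b) * (1 - x) - 3 * (1 - x) ^ 2) / 4 :=
      fun x hx => F1_insert_of_greatest_le ⟨hb, hmax⟩ (hs hb).1 hx
    refine ⟨hF, ?_, fun x hx => ⟨?_, fun h => ?_⟩⟩
    · rw [hF _ ⟨by linarith, by linarith⟩]
      ring
    · rw [hF x hx]
      linarith [sq_nonneg (1 - b - 3 * (1 - x))]
    · rw [hF x hx] at h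
      have hsq : (1 - b - 3 * (1 - x)) ^ 2 = 0 := by linarith
      linarith [pow_eq_zero_iff two_ne_zero |>.1 hsq]
end
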